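/- Let d ≥ 1, 1 ≤ p ≤ q < ∞, and let A = (A₁,A₂), B = (B₁,B₂) be pairs with all entries positive. Define H(x) = sup { ‖f‖_q : f nonzero Schwartz on ℝ^d, ‖ x^A f ‖_q ≤ x, ‖ ξ^B f̂ ‖_p ≤ 1 } for x > 0, and set m₁ = max(B₁ + d(1/p + 1/q − 1), 0), m₂ = B₂ + d(1/p + 1/q − 1). If B₂ ≥ d(1 − 1/p − 1/q), then there exist constants 0 < c ≤ C such that for all x > 0: c·x^{e(x)} ≤ H(x) ≤ C·x^{e(x)}, where e(x) = m₂/(A₁ + m₂) for x < 1 and e(x) = m₁/(A₂ + m₁) for x ≥ 1. If instead B₂ < d(1 − 1/p − 1/q), then H(x) = ∞ for every x > 0. -/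

import Mathlib

open MeasureTheory
open scoped ENNReal FourierTransform

/-- The broken power weight `x^A`: `|x|^{A₁}` for `|x| < 1`, `|x|^{A₂}` for `|x| ≥ 1`. -/
noncomputable def brokenWeight {d : ℕ} (A : ℝ × ℝ) (x : EuclideanSpace ℝ (Fin d)) : ℝ :=
  if ‖x‖ < 1 then ‖x‖ ^ A.1 else ‖x‖ ^ A.2

/-- `H(x) = sup { ‖f‖_q : f ≠ 0 Schwartz, ‖x^A f‖_q ≤ x, ‖ξ^B f̂‖_p ≤ 1 }`. -/
noncomputable def Hsup (d : ℕ) (A B : ℝ × ℝ) (q p : ℝ≥0∞) (x : ℝ) : ℝ≥0∞ :=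
  ⨆ f : {f : SchwartzMap (EuclideanSpace ℝ (Fin d)) ℂ // f ≠ 0 ∧
      eLpNorm (fun y => brokenWeight A y * ‖f y‖) q volume ≤ ENNReal.ofReal x ∧
      eLpNorm (fun ξ => brokenWeight B ξ * ‖𝓕 (⇑f) ξ‖) p volume ≤ 1},
    eLpNorm (⇑f.1) q volume

section Pitt

variable {E : Type*} [NormedAddCommGroup E] [InnerProductSpace ℝ E] [FiniteDimensional ℝ E]
  [MeasurableSpace E] [BorelSpace E]

theorem integral_fourier_smul_eq_of_integrable {f g : E → ℂ} (hf : Integrable f)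
    (hg : Integrable g) : ∫ ξ, 𝓕 f ξ • g ξ = ∫ x, f x • 𝓕 g x := by
  have := VectorFourier.integral_fourierIntegral_smul_eq_flip (μ := volume) (ν := volume)
    (L := innerₗ E) Real.continuous_fourierChar continuous_inner hf hg
  rw [flip_innerₗ] at this
  exact this

theorem fourier_ae_eq_fourier_toLp {g : E → ℂ} (h1 : Integrable g) (h2 : MemLp g 2) :
    𝓕 g =ᵐ[volume] (𝓕 (h2.toLp g) : Lp ℂ 2 (volume : Measure E)) := by
  have hcont : Continuous (𝓕 g) :=
    VectorFourier.fourierIntegral_continuous Real.continuous_fourierChar continuous_inner h1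
  have hloc : LocallyIntegrable
      (𝓕 g - ⇑(𝓕 (h2.toLp g) : Lp ℂ 2 (volume : Measure E))) volume :=
    hcont.locallyIntegrable.sub ((Lp.memLp _).locallyIntegrable one_le_two)
  have := ae_eq_zero_of_integral_contDiff_smul_eq_zero hloc ?_
  · filter_upwards [this] with x hx
    simpa [sub_eq_zero] using hx
  intro φ hφ hφc
  have hg₁ : HasCompactSupport (Complex.ofRealCLM ∘ φ) := hφc.comp_left rfl
  have hg₂ : ContDiff ℝ (⊤ : ℕ∞) (Complex.ofRealCLM ∘ φ) := by fun_prop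
  set ψ := hg₁.toSchwartzMap hg₂ with hψ
  have e1 : ∫ x, φ x • 𝓕 g x = ∫ x, 𝓕 (⇑ψ) x • g x := by
    rw [integral_fourier_smul_eq_of_integrable ψ.integrable h1]
    simp [hψ]
  have e2 : ∫ x, φ x • (𝓕 (h2.toLp g) : Lp ℂ 2 (volume : Measure E)) x
      = ∫ x, 𝓕 (⇑ψ) x • g x := by
    have h := congrArg (fun T => T ψ) (Lp.fourier_toTemperedDistribution_eq (h2.toLp g))
    simp only [TemperedDistribution.fourier_apply, Lp.toTemperedDistribution_apply] at h
    calc _ = ∫ x, ψ x • (𝓕 (h2.toLp g) : Lp ℂ 2 (volume : Measure E)) x := by simp [hψ]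
      _ = _ := h.symm
      _ = _ := by
        apply integral_congr_ae
        filter_upwards [h2.coeFn_toLp] with x hx
        rw [hx, SchwartzMap.fourier_coe]
  have i1 : Integrable (fun x => φ x • 𝓕 g x) :=
    (hφ.continuous.smul hcont).integrable_of_hasCompactSupport hφc.smul_right
  have i2 : Integrable (fun x => φ x • (𝓕 (h2.toLp g) : Lp ℂ 2 (volume : Measure E)) x) := 
    ((Lp.memLp _).locallyIntegrable one_le_two).integrable_smul_left_of_hasCompactSupport
      hφ.continuous hφc
  simp only [Pi.sub_apply, smul_sub]
  rw [integral_sub i1 i2, e1, e2, sub_self]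

theorem lintegral_enorm_fourier_sq_eq {g : E → ℂ} (h1 : Integrable g) (h2 : MemLp g 2) :
    ∫⁻ x, ‖𝓕 g x‖ₑ ^ (2 : ℝ) = ∫⁻ x, ‖g x‖ₑ ^ (2 : ℝ) := by
  have h : ‖𝓕 (h2.toLp g)‖ₑ = ‖h2.toLp g‖ₑ := by
    rw [← ofReal_norm, ← ofReal_norm, Lp.norm_fourier_eq]
  rw [Lp.enorm_def, Lp.enorm_def, eLpNorm_congr_ae h2.coeFn_toLp,
    ← eLpNorm_congr_ae (fourier_ae_eq_fourier_toLp h1 h2),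
    eLpNorm_eq_lintegral_rpow_enorm_toReal two_ne_zero ENNReal.ofNat_ne_top,
    eLpNorm_eq_lintegral_rpow_enorm_toReal two_ne_zero ENNReal.ofNat_ne_top] at h
  exact ENNReal.rpow_left_injective (by norm_num) h

theorem lintegral_indicator_rpow_le {a : ℝ} (ha : 0 < a) (l : ℝ≥0∞) :
    ∫⁻ t in Set.Ioi (0 : ℝ), {t : ℝ | ENNReal.ofReal t ≤ l}.indicator
      (fun t => ENNReal.ofReal (t ^ (a - 1))) t ≤ ENNReal.ofReal (1 / a) * l ^ a := by
  by_cases hl : l = ⊤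
  · rw [hl, ENNReal.top_rpow_of_pos ha, ENNReal.mul_top]
    · exact le_top
    · simpa using ha
  obtain ⟨b, hb, rfl⟩ : ∃ b : ℝ, 0 ≤ b ∧ l = ENNReal.ofReal b :=
    ⟨l.toReal, ENNReal.toReal_nonneg, (ENNReal.ofReal_toReal hl).symm⟩
  have hm : MeasurableSet {t : ℝ | ENNReal.ofReal t ≤ ENNReal.ofReal b} :=
    measurableSet_le (by fun_prop) measurable_const
  rw [lintegral_indicator hm, Measure.restrict_restrict hm]
  have hs : {t : ℝ | ENNReal.ofReal t ≤ ENNReal.ofReal b} ∩ Set.Ioi 0 = Set.Ioc 0 b := by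
    ext t
    simp only [Set.mem_inter_iff, Set.mem_ofPred_eq, Set.mem_Ioi, Set.mem_Ioc]
    rw [ENNReal.ofReal_le_ofReal_iff hb]
    tauto
  rw [hs]
  have h_integrable : IntegrableOn (fun t : ℝ => t ^ (a - 1)) (Set.Ioc 0 b) := by
    rw [← intervalIntegrable_iff_integrableOn_Ioc_of_le hb]
    exact intervalIntegral.intervalIntegrable_rpow' (by linarith)
  rw [← ofReal_integral_eq_lintegral_ofReal h_integrable, ← intervalIntegral.integral_of_le hb,
    integral_rpow (Or.inl (by linarith))]
  · rw [sub_add_cancel, Real.zero_rpow ha.ne', sub_zero, 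
      ENNReal.ofReal_rpow_of_nonneg hb ha.le, ← ENNReal.ofReal_mul (by positivity)]
    exact le_of_eq (by congr 1; ring)
  · filter_upwards [ae_restrict_mem measurableSet_Ioc] with t ht
    exact Real.rpow_nonneg ht.1.le _

theorem volume_lt_norm_fourier_le {g : E → ℂ} (h1 : Integrable g) (h2 : MemLp g 2)
    {s : Set E} (hs : MeasurableSet s) {t : ℝ} (ht : 0 < t)
    (hst : ∫⁻ ξ in s, ‖g ξ‖ₑ ≤ ENNReal.ofReal (t / 2)) :
    volume {x | t < ‖𝓕 g x‖} ≤
      ENNReal.ofReal (4 / t ^ 2) * ∫⁻ ξ in sᶜ, ‖g ξ‖ₑ ^ (2 : ℝ) := by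
  have i1 : Integrable (s.indicator g) := h1.indicator hs
  have i2 : Integrable (sᶜ.indicator g) := h1.indicator hs.compl
  have m2 : MemLp (sᶜ.indicator g) 2 := h2.indicator hs.compl
  have hsplit : 𝓕 g = 𝓕 (s.indicator g) + 𝓕 (sᶜ.indicator g) := by
    have := VectorFourier.fourierIntegral_add (μ := volume) (L := innerₗ E)
      Real.continuous_fourierChar continuous_inner i1 i2
    rw [Set.indicator_self_add_compl] at this
    exact this
  have hsmall : ∀ x, ‖𝓕 (s.indicator g) x‖ ≤ t / 2 := by
    intro x
    refine (VectorFourier.norm_fourierIntegral_le_integral_norm _ _ _ _ x).trans ?_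
    rw [integral_norm_eq_lintegral_enorm i1.1]
    simp only [enorm_indicator_eq_indicator_enorm]
    rw [lintegral_indicator hs]
    exact ENNReal.toReal_le_of_le_ofReal (by positivity) hst
  have hsub : {x | t < ‖𝓕 g x‖} ⊆
      {x | ENNReal.ofReal (t ^ 2 / 4) ≤ ‖𝓕 (sᶜ.indicator g) x‖ₑ ^ (2 : ℝ)} := by
    intro x hx
    have h3 : ‖𝓕 g x‖ ≤ ‖𝓕 (s.indicator g) x‖ + ‖𝓕 (sᶜ.indicator g) x‖ := by
      rw [hsplit]; exact norm_add_le _ _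
    have h4 : t / 2 ≤ ‖𝓕 (sᶜ.indicator g) x‖ := by
      have := hsmall x
      simp only [Set.mem_ofPred_eq] at hx
      linarith
    simp only [Set.mem_ofPred_eq]
    rw [← ofReal_norm, ENNReal.ofReal_rpow_of_nonneg (norm_nonneg _) zero_le_two]
    apply ENNReal.ofReal_le_ofReal
    rw [Real.rpow_two]
    nlinarith
  have hcont : Continuous (𝓕 (sᶜ.indicator g)) :=
    VectorFourier.fourierIntegral_continuous Real.continuous_fourierChar continuous_inner i2
  have ht2 : 0 < t ^ 2 / 4 := by positivity
  calc _ ≤ _ := measure_mono hsub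
    _ ≤ _ := meas_ge_le_lintegral_div (by fun_prop) (by simpa using ht2) ENNReal.ofReal_ne_top
    _ = _ := by
      rw [lintegral_enorm_fourier_sq_eq i2 m2, ENNReal.div_eq_inv_mul,
        ← ENNReal.ofReal_inv_of_pos ht2, inv_div, ← lintegral_indicator hs.compl]
      congr 2
      ext ξ
      by_cases h : ξ ∈ sᶜ <;> simp [h]

theorem lintegral_fourier_rpow_le {q : ℝ} (hq : 2 < q) {g : E → ℂ} (hg : Measurable g)
    (h1 : Integrable g) (h2 : MemLp g 2) {L : E → ℝ≥0∞} (hL : Measurable L)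
    (hLg : ∀ t : ℝ, 0 < t →
      ∫⁻ ξ in {ξ | L ξ < ENNReal.ofReal t}, ‖g ξ‖ₑ ≤ ENNReal.ofReal (t / 2)) :
    ∫⁻ x, ‖𝓕 g x‖ₑ ^ q ≤
      ENNReal.ofReal (4 * q / (q - 2)) * ∫⁻ ξ, ‖g ξ‖ₑ ^ (2 : ℝ) * L ξ ^ (q - 2) := by
  have hcont : Continuous (𝓕 g) :=
    VectorFourier.fourierIntegral_continuous Real.continuous_fourierChar continuous_inner h1
  have hq0 : 0 < q := by linarith
  calc ∫⁻ x, ‖𝓕 g x‖ₑ ^ q = ∫⁻ x, ENNReal.ofReal (‖𝓕 g x‖ ^ q) := by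
        congr with x
        rw [← ofReal_norm, ENNReal.ofReal_rpow_of_nonneg (norm_nonneg _) hq0.le]
    _ = ENNReal.ofReal q * ∫⁻ t in Set.Ioi (0 : ℝ), volume {x | t < ‖𝓕 g x‖} *
        ENNReal.ofReal (t ^ (q - 1)) :=
      lintegral_rpow_eq_lintegral_meas_lt_mul _ (Filter.Eventually.of_forall fun _ => norm_nonneg _)
        (by fun_prop) hq0
    _ ≤ ENNReal.ofReal q * ∫⁻ t in Set.Ioi (0 : ℝ), ∫⁻ ξ, ENNReal.ofReal 4 * (‖g ξ‖ₑ ^ (2 : ℝ) *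
        {t : ℝ | ENNReal.ofReal t ≤ L ξ}.indicator
          (fun t => ENNReal.ofReal (t ^ (q - 2 - 1))) t) := by
      gcongr ENNReal.ofReal q * ?_
      refine setLIntegral_mono' (measurableSet_Ioi (a := (0 : ℝ))) fun t ht => ?_
      have ht' : 0 < t := ht
      have hs : MeasurableSet {ξ | L ξ < ENNReal.ofReal t} :=
        measurableSet_lt hL measurable_const
      have := volume_lt_norm_fourier_le h1 h2 hs ht' (hLg t ht')
      calc _ ≤ (ENNReal.ofReal (4 / t ^ 2) * ∫⁻ ξ in {ξ | L ξ < ENNReal.ofReal t}ᶜ,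
            ‖g ξ‖ₑ ^ (2 : ℝ)) * ENNReal.ofReal (t ^ (q - 1)) := by gcongr
        _ = ENNReal.ofReal (4 * t ^ (q - 2 - 1)) * ∫⁻ ξ in {ξ | L ξ < ENNReal.ofReal t}ᶜ,
            ‖g ξ‖ₑ ^ (2 : ℝ) := by
          rw [mul_right_comm, ← ENNReal.ofReal_mul (by positivity)]
          congr 2
          rw [show q - 1 = (q - 2 - 1) + 2 by ring, Real.rpow_add ht', Real.rpow_two]
          field_simp
        _ = _ := by
          rw [← lintegral_indicator hs.compl, ← lintegral_const_mul _
            ((hg.enorm.pow_const _).indicator hs.compl)]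
          congr with ξ
          rw [ENNReal.ofReal_mul (by norm_num), mul_assoc]
          by_cases h : L ξ < ENNReal.ofReal t
          · simp [h]
          · simp [h, not_lt.1 h, mul_comm]
    _ = ENNReal.ofReal q * ∫⁻ ξ, ∫⁻ t in Set.Ioi (0 : ℝ), ENNReal.ofReal 4 * (‖g ξ‖ₑ ^ (2 : ℝ) *
        {t : ℝ | ENNReal.ofReal t ≤ L ξ}.indicator
          (fun t => ENNReal.ofReal (t ^ (q - 2 - 1))) t) := by
      rw [lintegral_lintegral_swap]
      refine Measurable.aemeasurable ?_
      refine measurable_const.mul (Measurable.mul (by fun_prop) ?_)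
      have : MeasurableSet {z : ℝ × E | ENNReal.ofReal z.1 ≤ L z.2} :=
        measurableSet_le (by fun_prop) (by fun_prop)
      exact Measurable.indicator
        (f := fun z : ℝ × E => ENNReal.ofReal (z.1 ^ (q - 2 - 1))) (by fun_prop) this
    _ ≤ ENNReal.ofReal q * ∫⁻ ξ, ENNReal.ofReal (4 / (q - 2)) *
          (‖g ξ‖ₑ ^ (2 : ℝ) * L ξ ^ (q - 2)) := by
      gcongr with ξ
      have hm : Measurable ({t : ℝ | ENNReal.ofReal t ≤ L ξ}.indicator
          (fun t => ENNReal.ofReal (t ^ (q - 2 - 1)))) :=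
        Measurable.indicator (by fun_prop) (measurableSet_le (by fun_prop) measurable_const)
      rw [lintegral_const_mul _ (hm.const_mul _), lintegral_const_mul _ hm]
      grw [lintegral_indicator_rpow_le (by linarith : 0 < q - 2)]
      rw [div_eq_mul_one_div (4 : ℝ), ENNReal.ofReal_mul (by norm_num : (0 : ℝ) ≤ 4)]
      exact le_of_eq (by ring)
    _ = _ := by
      rw [lintegral_const_mul _ (by fun_prop), ← mul_assoc, ← ENNReal.ofReal_mul hq0.le]
      congr 2
      ring

theorem lintegral_eq_mul_lintegral_comp_smul (F : E → ℝ≥0∞) {r : ℝ} (hr : 0 < r) :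
    ∫⁻ x, F x = ENNReal.ofReal (r ^ Module.finrank ℝ E) * ∫⁻ x, F (r • x) := by
  have h : ∫⁻ x, F (r • x) = ∫⁻ x, F x ∂(Measure.map (fun x => r • x) (volume : Measure E)) :=
    ((Homeomorph.smulOfNeZero r hr.ne').toMeasurableEquiv.measurableEmbedding.lintegral_map F).symm
  rw [h, Measure.map_addHaar_smul _ hr.ne', lintegral_smul_measure, smul_eq_mul, ← mul_assoc,
    ← ENNReal.ofReal_mul (by positivity), abs_of_pos (by positivity),
    mul_inv_cancel₀ (by positivity), ENNReal.ofReal_one, one_mul]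

theorem enorm_smul_rpow {V : Type*} [NormedAddCommGroup V] [NormedSpace ℝ V] (x : V) {r : ℝ}
    (hr : 0 < r) (b : ℝ) :
    ‖r • x‖ₑ ^ b = ENNReal.ofReal r ^ b * ‖x‖ₑ ^ b := by
  rw [enorm_smul, Real.enorm_of_nonneg hr.le,
    ENNReal.mul_rpow_of_ne_top ENNReal.ofReal_ne_top enorm_ne_top]

theorem setLIntegral_enorm_rpow_smul (s : Set E) (hs : MeasurableSet s) {r : ℝ} (hr : 0 < r)
    (b : ℝ) :
    ∫⁻ x in {x | r⁻¹ • x ∈ s}, ‖x‖ₑ ^ b =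
      ENNReal.ofReal r ^ (Module.finrank ℝ E + b) * ∫⁻ x in s, ‖x‖ₑ ^ b := by
  have hs' : MeasurableSet {x | r⁻¹ • x ∈ s} := (measurable_const_smul r⁻¹) hs
  have hr0 : ENNReal.ofReal r ≠ 0 := by simpa using hr
  rw [← lintegral_indicator hs', ← lintegral_indicator hs,
    lintegral_eq_mul_lintegral_comp_smul _ hr, ENNReal.rpow_add _ _ hr0 ENNReal.ofReal_ne_top,
    mul_assoc, ← lintegral_const_mul _ (Measurable.indicator (by fun_prop) hs),
    ENNReal.rpow_natCast, ENNReal.ofReal_pow hr.le]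
  congr with x
  by_cases hx : x ∈ s
  · rw [Set.indicator_of_mem hx, Set.indicator_of_mem (by simpa [hr.ne'] using hx),
      enorm_smul_rpow x hr]
  · rw [Set.indicator_of_notMem hx, Set.indicator_of_notMem (by simpa [hr.ne'] using hx), mul_zero]

theorem setLIntegral_closedBall_enorm_rpow [Nontrivial E] {a : ℝ}
    (ha : a < Module.finrank ℝ E) :
    ∃ C : ℝ≥0∞, C ≠ ⊤ ∧ ∀ R : ℝ, 0 < R →
      ∫⁻ x in Metric.closedBall (0 : E) R, ‖x‖ₑ ^ (-a) ≤
        C * ENNReal.ofReal R ^ (Module.finrank ℝ E - a) := by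
  refine ⟨∫⁻ x in Metric.closedBall (0 : E) 1, ‖x‖ₑ ^ (-a), ?_, fun R hR => ?_⟩
  · have hi : IntegrableOn (fun x : E => ‖x‖ ^ (-a)) (Metric.ball 0 2) :=
      integrableOn_ball_of_norm_le_rpow (C := 1) Module.finrank_pos ha
        (Filter.Eventually.of_forall fun x => by
          rw [one_mul, Real.norm_of_nonneg (by positivity)])
        (by exact (measurable_norm.pow_const _).aestronglyMeasurable)
    have h2 := hi.2
    refine ne_of_lt (lt_of_le_of_lt ?_ h2)
    refine (lintegral_mono_set (Metric.closedBall_subset_ball one_lt_two)).trans ?_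
    refine lintegral_mono_ae (ae_restrict_of_ae ?_)
    filter_upwards [Measure.ae_ne volume (0 : E)] with x hx
    rw [← ofReal_norm, ENNReal.ofReal_rpow_of_pos (norm_pos_iff.2 hx),
      Real.enorm_of_nonneg (by positivity)]
  · have := setLIntegral_enorm_rpow_smul (Metric.closedBall (0 : E) 1)
      measurableSet_closedBall hR (-a)
    have hs : {x : E | R⁻¹ • x ∈ Metric.closedBall (0 : E) 1} = Metric.closedBall 0 R := by
      ext x
      simp [norm_smul, abs_of_pos hR, inv_mul_le_iff₀ hR]
    rw [hs] at this
    rw [this, mul_comm, sub_eq_add_neg]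

theorem setLIntegral_norm_ge_enorm_rpow {a : ℝ} (ha : Module.finrank ℝ E < a) :
    ∃ C : ℝ≥0∞, C ≠ ⊤ ∧ ∀ R : ℝ, 0 < R →
      ∫⁻ x in {x : E | R ≤ ‖x‖}, ‖x‖ₑ ^ (-a) ≤
        C * ENNReal.ofReal R ^ (Module.finrank ℝ E - a) := by
  have hm : MeasurableSet {x : E | 1 ≤ ‖x‖} := measurableSet_le measurable_const measurable_norm
  refine ⟨∫⁻ x in {x : E | 1 ≤ ‖x‖}, ‖x‖ₑ ^ (-a), ?_, fun R hR => ?_⟩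
  · have h2 := finite_integral_one_add_norm (μ := (volume : Measure E)) ha
    have h0 : (0 : ℝ) ≤ a := (Nat.cast_nonneg _).trans ha.le
    refine ne_of_lt (lt_of_le_of_lt ?_ (ENNReal.mul_lt_top
      (ENNReal.ofReal_lt_top (r := 2 ^ a)) h2))
    rw [← lintegral_const_mul _ (by fun_prop)]
    refine le_trans ?_ (setLIntegral_le_lintegral {x : E | 1 ≤ ‖x‖} _)
    refine setLIntegral_mono' hm fun x (hx : 1 ≤ ‖x‖) => ?_
    have hx0 : 0 < ‖x‖ := by linarith
    rw [← ofReal_norm, ENNReal.ofReal_rpow_of_pos hx0, ← ENNReal.ofReal_mul (by positivity)]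
    apply ENNReal.ofReal_le_ofReal
    rw [Real.rpow_neg hx0.le, Real.rpow_neg (by positivity), ← div_eq_mul_inv,
      ← Real.div_rpow (by norm_num) (by positivity), ← Real.inv_rpow (by positivity)]
    apply Real.rpow_le_rpow (by positivity) _ h0
    rw [inv_eq_one_div, div_le_div_iff₀ hx0 (by positivity)]
    linarith
  · have := setLIntegral_enorm_rpow_smul {x : E | 1 ≤ ‖x‖} hm hR (-a)
    have hs : {x : E | R⁻¹ • x ∈ {x : E | 1 ≤ ‖x‖}} = {x : E | R ≤ ‖x‖} := by
      ext x
      simp [norm_smul, abs_of_pos hR, le_inv_mul_iff₀ hR]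
    rw [hs] at this
    rw [this, mul_comm, sub_eq_add_neg]

theorem enorm_rpow_mul_enorm_rpow_neg {V : Type*} [NormedAddCommGroup V] {x : V} (hx : x ≠ 0)
    (a : ℝ) :
    ‖x‖ₑ ^ (-a) * ‖x‖ₑ ^ a = 1 := by
  rw [← ENNReal.rpow_add _ _ (by simpa using hx) enorm_ne_top, neg_add_cancel, ENNReal.rpow_zero]

/-- Hölder's inequality on a ball against a power weight. -/
theorem setLIntegral_closedBall_le_weighted [Nontrivial E] {p p' β ε : ℝ}
    (hp : p.HolderConjugate p') (h : (β + ε) * p' < Module.finrank ℝ E) :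
    ∃ C : ℝ≥0∞, C ≠ ⊤ ∧ ∀ G : E → ℝ≥0∞, Measurable G → ∀ R : ℝ, 0 < R →
      ∫⁻ x in Metric.closedBall (0 : E) R, G x ≤
        C * ENNReal.ofReal R ^ (Module.finrank ℝ E / p' - (β + ε)) *
          (∫⁻ x in Metric.closedBall (0 : E) R, (‖x‖ₑ ^ β * G x) ^ p * ‖x‖ₑ ^ (ε * p)) ^
            (1 / p) := by
  obtain ⟨C, hC, hCR⟩ := setLIntegral_closedBall_enorm_rpow (E := E) h
  have hp' := hp.symm.pos
  refine ⟨C ^ (1 / p'), ENNReal.rpow_ne_top_of_nonneg (by positivity) hC, fun G hG R hR => ?_⟩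
  have hH := ENNReal.lintegral_mul_le_Lp_mul_Lq (volume.restrict (Metric.closedBall (0 : E) R))
    hp (f := fun x => ‖x‖ₑ ^ (β + ε) * G x) (g := fun x => ‖x‖ₑ ^ (-(β + ε)))
    (by fun_prop) (by fun_prop)
  calc ∫⁻ x in Metric.closedBall (0 : E) R, G x
      = ∫⁻ x in Metric.closedBall (0 : E) R,
          ((fun x : E => ‖x‖ₑ ^ (β + ε) * G x) * (fun x : E => ‖x‖ₑ ^ (-(β + ε)))) x := by
        refine lintegral_congr_ae (ae_restrict_of_ae ?_)
        filter_upwards [Measure.ae_ne volume (0 : E)] with x hx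
        rw [Pi.mul_apply, mul_comm, ← mul_assoc, enorm_rpow_mul_enorm_rpow_neg hx, one_mul]
    _ ≤ _ := hH
    _ = (∫⁻ x in Metric.closedBall (0 : E) R, (‖x‖ₑ ^ β * G x) ^ p * ‖x‖ₑ ^ (ε * p)) ^ (1 / p) *
        (∫⁻ x in Metric.closedBall (0 : E) R, ‖x‖ₑ ^ (-((β + ε) * p'))) ^ (1 / p') := by
        congr 2
        · refine lintegral_congr_ae (ae_restrict_of_ae ?_)
          filter_upwards [Measure.ae_ne volume (0 : E)] with x hx
          rw [ENNReal.rpow_add _ _ (by simpa using hx) enorm_ne_top, mul_right_comm,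
            ENNReal.mul_rpow_of_nonneg _ _ hp.nonneg, ← ENNReal.rpow_mul]
        · congr with x
          rw [← ENNReal.rpow_mul, neg_mul]
    _ ≤ _ * (C * ENNReal.ofReal R ^ (Module.finrank ℝ E - (β + ε) * p')) ^ (1 / p') := by
        gcongr
        exact hCR R hR
    _ = _ := by
        rw [ENNReal.mul_rpow_of_nonneg _ _ (by positivity), ← ENNReal.rpow_mul, mul_comm]
        congr 3
        field_simp

/-- A finite measure gives mass at most `c` to the union of the centred balls of mass less
than `c`. -/
theorem measure_setOf_measure_closedBall_norm_lt_le (ν : Measure E) [IsFiniteMeasure ν]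
    (c : ℝ≥0∞) : ν {x : E | ν (Metric.closedBall 0 ‖x‖) < c} ≤ c := by
  have hmono : Monotone fun r : ℝ => ν (Metric.closedBall (0 : E) r) := fun r s hrs =>
    measure_mono (Metric.closedBall_subset_closedBall hrs)
  have hm : MeasurableSet {x : E | ν (Metric.closedBall 0 ‖x‖) < c} :=
    measurableSet_lt (hmono.measurable.comp measurable_norm) measurable_const
  rw [hm.measure_eq_iSup_isCompact ν]
  refine iSup_le fun K => iSup_le fun hK => iSup_le fun hKc => ?_
  rcases K.eq_empty_or_nonempty with rfl | hne
  · simp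
  obtain ⟨x, hx, hmax⟩ := hKc.exists_isMaxOn hne continuous_norm.continuousOn
  refine (measure_mono (t := Metric.closedBall 0 ‖x‖) fun y hy => ?_).trans (hK hx).le
  simpa using hmax hy

theorem ENNReal.sq_mul_rpow_le_add {p : ℝ} (hp : 2 ≤ p) (X P : ℝ≥0∞) :
    X ^ (2 : ℝ) * P ^ ((p - 2) / p) ≤ X ^ p + P := by
  have hp0 : 0 < p := by linarith
  have hX : X ^ (2 : ℝ) = (X ^ p) ^ (2 / p) := by
    rw [← ENNReal.rpow_mul]; congr 1; field_simp
  rw [hX]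
  calc _ ≤ (X ^ p + P) ^ (2 / p) * (X ^ p + P) ^ ((p - 2) / p) := by
        exact mul_le_mul' (ENNReal.rpow_le_rpow le_self_add (by positivity))
          (ENNReal.rpow_le_rpow le_add_self (div_nonneg (by linarith) hp0.le))
    _ = (X ^ p + P) := by
        rw [← ENNReal.rpow_add_of_nonneg _ _ (by positivity) (div_nonneg (by linarith) hp0.le),
          ← add_div, show (2 + (p - 2)) / p = 1 by field_simp; ring, ENNReal.rpow_one]

/-- Weighted Hardy inequality for means over centred balls, at the trivial endpoint. -/
theorem lintegral_enorm_rpow_mul_setLIntegral_closedBall_le [Nontrivial E] {b : ℝ} (hb : 0 < b) :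
    ∃ C : ℝ≥0∞, C ≠ ⊤ ∧ ∀ H : E → ℝ≥0∞, Measurable H →
      (∫⁻ x : E, ‖x‖ₑ ^ (-((Module.finrank ℝ E : ℝ) + b)) *
        ∫⁻ y in Metric.closedBall (0 : E) ‖x‖, H y * ‖y‖ₑ ^ b) ≤ C * ∫⁻ y, H y := by
  obtain ⟨C, hC, hCR⟩ := setLIntegral_norm_ge_enorm_rpow (E := E)
    (a := (Module.finrank ℝ E : ℝ) + b) (by linarith)
  refine ⟨C, hC, fun H hH => ?_⟩
  have hm : MeasurableSet {z : E × E | ‖z.2‖ ≤ ‖z.1‖} :=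
    measurableSet_le (by fun_prop) (by fun_prop)
  calc _ = ∫⁻ x, ∫⁻ y, {z : E × E | ‖z.2‖ ≤ ‖z.1‖}.indicator
          (fun z => ‖z.1‖ₑ ^ (-((Module.finrank ℝ E : ℝ) + b)) * (H z.2 * ‖z.2‖ₑ ^ b)) (x, y) := by
        congr with x
        rw [← lintegral_const_mul _ (by fun_prop), ← lintegral_indicator measurableSet_closedBall]
        congr with y
        by_cases h : ‖y‖ ≤ ‖x‖ <;> simp [Set.indicator, h]
    _ = ∫⁻ y, ∫⁻ x, {z : E × E | ‖z.2‖ ≤ ‖z.1‖}.indicator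
          (fun z => ‖z.1‖ₑ ^ (-((Module.finrank ℝ E : ℝ) + b)) * (H z.2 * ‖z.2‖ₑ ^ b)) (x, y) := by
        rw [lintegral_lintegral_swap]
        exact (Measurable.indicator (by fun_prop) hm).aemeasurable
    _ = ∫⁻ y, (H y * ‖y‖ₑ ^ b) *
          ∫⁻ x in {x : E | ‖y‖ ≤ ‖x‖}, ‖x‖ₑ ^ (-((Module.finrank ℝ E : ℝ) + b)) := by
        congr with y
        have hmy : MeasurableSet {x : E | ‖y‖ ≤ ‖x‖} :=
          measurableSet_le measurable_const measurable_norm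
        rw [← lintegral_const_mul _ (by fun_prop), ← lintegral_indicator hmy]
        congr with x
        by_cases h : ‖y‖ ≤ ‖x‖ <;> simp [Set.indicator, h, mul_comm]
    _ ≤ ∫⁻ y, C * H y := by
        refine lintegral_mono_ae ?_
        filter_upwards [Measure.ae_ne volume (0 : E)] with y hy
        grw [hCR ‖y‖ (norm_pos_iff.2 hy)]
        rw [ofReal_norm,
          show (Module.finrank ℝ E : ℝ) - ((Module.finrank ℝ E : ℝ) + b) = -b by ring]
        calc _ = C * H y * (‖y‖ₑ ^ (-b) * ‖y‖ₑ ^ b) := by ring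
          _ ≤ _ := by rw [enorm_rpow_mul_enorm_rpow_neg hy, mul_one]
    _ = _ := lintegral_const_mul _ hH

theorem lintegral_fourier_rpow_le_of_two_le [Nontrivial E] {p q β : ℝ} (hp : 2 ≤ p) (hpq : p ≤ q)
    (hq : 2 < q) (hβ : β = Module.finrank ℝ E * (1 - 1 / p - 1 / q)) :
    ∃ C : ℝ≥0∞, C ≠ ⊤ ∧ ∀ g : E → ℂ, Measurable g → Integrable g → MemLp g 2 →
      ∫⁻ x, (‖x‖ₑ ^ β * ‖g x‖ₑ) ^ p ≤ 1 → ∫⁻ x, ‖𝓕 g x‖ₑ ^ q ≤ C := by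
  set n : ℝ := ((Module.finrank ℝ E : ℕ) : ℝ) with hn
  have hn0 : 0 < n := by rw [hn]; exact_mod_cast Module.finrank_pos
  have hp0 : 0 < p := by linarith
  have hq0 : 0 < q := by linarith
  set ε := n / (2 * q) with hε
  have hε0 : 0 < ε := by positivity
  have hconj := Real.HolderConjugate.conjExponent (by linarith : 1 < p)
  set p' := p.conjExponent
  have hp' : 0 < p' := hconj.symm.pos
  have hp'inv : 1 / p' = 1 - 1 / p := by
    have := hconj.inv_add_inv_eq_one
    simp only [one_div]; linarith
  have e1 : n / p' - (β + ε) = n / q - ε := by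
    rw [div_eq_mul_one_div n p', hp'inv, hβ, div_eq_mul_one_div n q]; ring
  have h1 : (β + ε) * p' < n := by
    have : 0 < n / p' - (β + ε) := by
      rw [e1, hε, sub_pos]
      gcongr; linarith
    rwa [sub_pos, lt_div_iff₀ hp'] at this
  obtain ⟨C₁, hC₁, hH⟩ := setLIntegral_closedBall_le_weighted (E := E) hconj h1
  obtain ⟨C₂, hC₂, hS⟩ := lintegral_enorm_rpow_mul_setLIntegral_closedBall_le (E := E)
    (b := ε * p) (by positivity)
  rw [← hn, e1] at hH
  rw [← hn] at hS
  refine ⟨ENNReal.ofReal (4 * q / (q - 2)) * ((2 * C₁) ^ (q - 2) * (1 + C₂)), ?_,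
    fun g hgm hg1 hg2 hle => ?_⟩
  · have : (2 * C₁) ^ (q - 2) ≠ ⊤ :=
      ENNReal.rpow_ne_top_of_nonneg (by linarith) (by finiteness)
    finiteness
  set ν := (volume : Measure E).withDensity fun x => ‖g x‖ₑ with hν
  have : IsFiniteMeasure ν := ⟨by
    rw [hν, withDensity_apply _ MeasurableSet.univ, Measure.restrict_univ]; exact hg1.2⟩
  have hmono : Monotone fun r : ℝ => ν (Metric.closedBall (0 : E) r) := fun r s hrs =>
    measure_mono (Metric.closedBall_subset_closedBall hrs)
  set L : E → ℝ≥0∞ := fun x => 2 * ν (Metric.closedBall 0 ‖x‖) with hL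
  have hLm : Measurable L := measurable_const.mul (hmono.measurable.comp measurable_norm)
  set H : E → ℝ≥0∞ := fun x => (‖x‖ₑ ^ β * ‖g x‖ₑ) ^ p with hHdef
  have hHm : Measurable H := by fun_prop
  set P : E → ℝ≥0∞ := fun x => ‖x‖ₑ ^ (-(ε * p)) *
    ∫⁻ y in Metric.closedBall (0 : E) ‖x‖, H y * ‖y‖ₑ ^ (ε * p) with hP
  refine (lintegral_fourier_rpow_le hq hgm hg1 hg2 hLm fun t ht => ?_).trans ?_
  · have hs : MeasurableSet {ξ | L ξ < ENNReal.ofReal t} := measurableSet_lt hLm measurable_const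
    rw [← withDensity_apply _ hs]
    refine le_trans (measure_mono fun x hx => ?_)
      (measure_setOf_measure_closedBall_norm_lt_le ν (ENNReal.ofReal (t / 2)))
    simp only [Set.mem_ofPred_eq, hL] at hx ⊢
    rw [ENNReal.ofReal_div_of_pos two_pos, ENNReal.ofReal_ofNat,
      ENNReal.lt_div_iff_mul_lt (by simp) (by simp), mul_comm]
    exact hx
  gcongr
  have hLle : ∀ x : E, x ≠ 0 → L x ≤ 2 * C₁ * (‖x‖ₑ ^ (n / q) * P x ^ (1 / p)) := by
    intro x hx
    simp only [hL, hν, withDensity_apply _ measurableSet_closedBall]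
    grw [hH _ hgm.enorm ‖x‖ (norm_pos_iff.2 hx)]
    rw [ofReal_norm, hP, ENNReal.mul_rpow_of_nonneg _ _ (by positivity), ← ENNReal.rpow_mul,
      sub_eq_add_neg, ENNReal.rpow_add _ _ (by simpa using hx) enorm_ne_top,
      show -(ε * p) * (1 / p) = -ε by field_simp]
    exact le_of_eq (by ring)
  have hP1 : ∀ x : E, x ≠ 0 → P x ≤ 1 := by
    intro x hx
    calc P x ≤ ‖x‖ₑ ^ (-(ε * p)) * ∫⁻ y in Metric.closedBall (0 : E) ‖x‖, H y * ‖x‖ₑ ^ (ε * p) := by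
          refine mul_le_mul_right (setLIntegral_mono' measurableSet_closedBall fun y hy => ?_) _
          have hy' : ‖y‖ₑ ≤ ‖x‖ₑ := by
            rw [← ofReal_norm, ← ofReal_norm]
            exact ENNReal.ofReal_le_ofReal (by simpa using hy)
          gcongr
      _ ≤ ‖x‖ₑ ^ (-(ε * p)) * (1 * ‖x‖ₑ ^ (ε * p)) := by
          rw [lintegral_mul_const _ hHm]
          gcongr
          exact (setLIntegral_le_lintegral _ _).trans hle
      _ = 1 := by rw [one_mul, enorm_rpow_mul_enorm_rpow_neg hx]
  calc ∫⁻ x, ‖g x‖ₑ ^ (2 : ℝ) * L x ^ (q - 2)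
      ≤ ∫⁻ x, (2 * C₁) ^ (q - 2) * (H x + ‖x‖ₑ ^ (-(n + ε * p)) *
          ∫⁻ y in Metric.closedBall (0 : E) ‖x‖, H y * ‖y‖ₑ ^ (ε * p)) := by
        refine lintegral_mono_ae ?_
        filter_upwards [Measure.ae_ne volume (0 : E)] with x hx
        have hx0 : ‖x‖ₑ ≠ 0 := by simpa using hx
        have hadd : ∀ a b : ℝ, ‖x‖ₑ ^ a * ‖x‖ₑ ^ b = ‖x‖ₑ ^ (a + b) := fun a b =>
          (ENNReal.rpow_add _ _ hx0 enorm_ne_top).symm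
        have hPpow : P x ^ (1 / p * (q - 2)) ≤ P x ^ ((p - 2) / p) := by
          apply ENNReal.rpow_le_rpow_of_exponent_ge (hP1 x hx)
          rw [one_div, inv_mul_eq_div]
          gcongr
        have hgX : ‖g x‖ₑ ^ (2 : ℝ) * ‖x‖ₑ ^ (n / q * (q - 2)) =
            ‖x‖ₑ ^ (-n) * (‖x‖ₑ ^ (n / p + β) * ‖g x‖ₑ) ^ (2 : ℝ) := by
          rw [ENNReal.mul_rpow_of_nonneg _ _ zero_le_two, ← ENNReal.rpow_mul, ← mul_assoc, hadd,
            mul_comm]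
          congr 2
          rw [hβ]
          field_simp
          ring
        calc _ ≤ ‖g x‖ₑ ^ (2 : ℝ) * (2 * C₁ * (‖x‖ₑ ^ (n / q) * P x ^ (1 / p))) ^ (q - 2) := by
              gcongr
              exact hLle x hx
          _ = (2 * C₁) ^ (q - 2) * ((‖g x‖ₑ ^ (2 : ℝ) * ‖x‖ₑ ^ (n / q * (q - 2))) *
                P x ^ (1 / p * (q - 2))) := by
              rw [ENNReal.mul_rpow_of_nonneg (2 * C₁) _ (by linarith),
                ENNReal.mul_rpow_of_nonneg (‖x‖ₑ ^ (n / q)) _ (by linarith), ← ENNReal.rpow_mul,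
                ← ENNReal.rpow_mul]
              ring
          _ ≤ (2 * C₁) ^ (q - 2) * (‖x‖ₑ ^ (-n) *
                ((‖x‖ₑ ^ (n / p + β) * ‖g x‖ₑ) ^ (2 : ℝ) * P x ^ ((p - 2) / p))) := by
              rw [hgX, mul_assoc]
              gcongr
          _ ≤ (2 * C₁) ^ (q - 2) * (‖x‖ₑ ^ (-n) *
                ((‖x‖ₑ ^ (n / p + β) * ‖g x‖ₑ) ^ p + P x)) := by
              gcongr
              exact ENNReal.sq_mul_rpow_le_add hp _ _
          _ = _ := by
              rw [mul_add (‖x‖ₑ ^ (-n)), hP]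
              simp only
              rw [← mul_assoc (‖x‖ₑ ^ (-n)), hadd, neg_add]
              congr 2
              simp only [hHdef]
              rw [← hadd, mul_assoc, ENNReal.mul_rpow_of_nonneg _ _ hp0.le, ← ENNReal.rpow_mul,
                div_mul_cancel₀ _ hp0.ne', ← mul_assoc, enorm_rpow_mul_enorm_rpow_neg hx, one_mul]
    _ ≤ (2 * C₁) ^ (q - 2) * (1 + C₂) := by
        rw [lintegral_const_mul' _ _
          (ENNReal.rpow_ne_top_of_nonneg (by linarith) (by finiteness)), lintegral_add_left hHm]
        gcongr
        refine (hS H hHm).trans ?_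
        grw [hle]
        rw [mul_one]

theorem lintegral_fourier_rpow_le_of_lt_two [Nontrivial E] {p q β : ℝ} (hp1 : 1 < p) (hp : p < 2)
    (hq : 2 < q) (hβ0 : 0 ≤ β) (hβ : β = Module.finrank ℝ E * (1 - 1 / p - 1 / q)) :
    ∃ C : ℝ≥0∞, C ≠ ⊤ ∧ ∀ g : E → ℂ, Measurable g → Integrable g → MemLp g 2 →
      ∫⁻ x, (‖x‖ₑ ^ β * ‖g x‖ₑ) ^ p ≤ 1 → ∫⁻ x, ‖𝓕 g x‖ₑ ^ q ≤ C := by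
  set n : ℝ := ((Module.finrank ℝ E : ℕ) : ℝ) with hn
  have hn0 : 0 < n := by rw [hn]; exact_mod_cast Module.finrank_pos
  have hp0 : 0 < p := by linarith
  have hq0 : 0 < q := by linarith
  have hconj := Real.HolderConjugate.conjExponent hp1
  set p' := p.conjExponent
  have hp' : 0 < p' := hconj.symm.pos
  have hp'inv : 1 / p' = 1 - 1 / p := by
    have := hconj.inv_add_inv_eq_one
    simp only [one_div]; linarith
  have e1 : n / p' - (β + 0) = n / q := by
    rw [div_eq_mul_one_div n p', hp'inv, hβ, div_eq_mul_one_div n q]; ring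
  have h1 : (β + 0) * p' < n := by
    have : 0 < n / p' - (β + 0) := by
      rw [e1]; positivity
    rwa [sub_pos, lt_div_iff₀ hp'] at this
  obtain ⟨C₁, hC₁, hH⟩ := setLIntegral_closedBall_le_weighted (E := E) hconj h1
  rw [← hn, e1] at hH
  lift C₁ to NNReal using hC₁
  set K : ℝ := 2 * (C₁ + 1) with hK
  have hK0 : 0 < K := by positivity
  refine ⟨ENNReal.ofReal (4 * q / (q - 2)) * (ENNReal.ofReal K) ^ (q - 2), ?_,
    fun g hgm hg1 hg2 hle => ?_⟩
  · have : (ENNReal.ofReal K) ^ (q - 2) ≠ ⊤ :=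
      ENNReal.rpow_ne_top_of_nonneg (by linarith) (by finiteness)
    finiteness
  set L : E → ℝ≥0∞ := fun x =>
    ENNReal.ofReal K * (‖x‖ₑ ^ (β * p) * ‖g x‖ₑ ^ (p - 2)) ^ (1 / (q - 2)) with hL
  have hLm : Measurable L := by fun_prop
  have hHm : Measurable fun x => (‖x‖ₑ ^ β * ‖g x‖ₑ) ^ p := by fun_prop
  refine (lintegral_fourier_rpow_le hq hgm hg1 hg2 hLm fun t ht => ?_).trans ?_
  · set ν := t / K with hν
    have hν0 : 0 < ν := by positivity
    set R := ν ^ (q / n) with hR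
    have hR0 : 0 < R := by positivity
    have hball := hH _ hgm.enorm R hR0
    have hs : MeasurableSet {ξ | L ξ < ENNReal.ofReal t} := measurableSet_lt hLm measurable_const
    have hpt : ∀ x, L x < ENNReal.ofReal t →
        ‖g x‖ₑ ≤ (Metric.closedBall (0 : E) R).indicator (fun x => ‖g x‖ₑ) x +
          ENNReal.ofReal ν * (‖x‖ₑ ^ β * ‖g x‖ₑ) ^ p := by
      intro x hx
      by_cases hxR : x ∈ Metric.closedBall (0 : E) R
      · rw [Set.indicator_of_mem hxR]; exact le_self_add
      rw [Set.indicator_of_notMem hxR, zero_add]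
      have hxR' : R < ‖x‖ := by simpa using hxR
      have hx0 : 0 < ‖x‖ := hR0.trans hxR'
      by_cases hg0 : g x = 0
      · simp [hg0]
      have hgx : 0 < ‖g x‖ := norm_pos_iff.2 hg0
      simp only [hL] at hx
      rw [← ofReal_norm, ← ofReal_norm, ENNReal.ofReal_rpow_of_pos hx0,
        ENNReal.ofReal_rpow_of_pos hgx, ← ENNReal.ofReal_mul (by positivity),
        ENNReal.ofReal_rpow_of_pos (by positivity), ← ENNReal.ofReal_mul (by positivity),
        ENNReal.ofReal_lt_ofReal_iff ht, ← lt_div_iff₀' hK0, ← hν] at hx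
      rw [← ofReal_norm, ← ofReal_norm, ENNReal.ofReal_rpow_of_pos hx0,
        ← ENNReal.ofReal_mul (by positivity), ENNReal.ofReal_rpow_of_pos (by positivity),
        ← ENNReal.ofReal_mul (by positivity)]
      apply ENNReal.ofReal_le_ofReal
      have hlx := Real.log_lt_log (by positivity) hx
      rw [Real.log_rpow (by positivity), Real.log_mul (by positivity) (by positivity),
        Real.log_rpow hx0, Real.log_rpow hgx, one_div, inv_mul_lt_iff₀ (by linarith)] at hlx
      have hlR := Real.log_lt_log hR0 hxR'
      rw [hR, Real.log_rpow hν0] at hlR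
      rw [← Real.log_le_log_iff hgx (by positivity), Real.log_mul (by positivity) (by positivity),
        Real.log_rpow (by positivity), Real.log_mul (by positivity) (by positivity),
        Real.log_rpow hx0]
      generalize Real.log ‖x‖ = X at *
      generalize Real.log ‖g x‖ = Y at *
      generalize Real.log ν = N at *
      have hβn : β * p * (q / n) = (p - 1) * (q - 2) - (2 - p) := by
        rw [hβ]; field_simp; ring
      have k1 : β * p * (q / n * N) ≤ β * p * X :=
        mul_le_mul_of_nonneg_left hlR.le (by positivity)
      rw [← mul_assoc, hβn] at k1
      have k2 := mul_lt_mul_of_pos_left hlx (by linarith : 0 < p - 1)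
      have k3 : 0 ≤ (2 - p) * (N + p * (β * X + Y) - Y) := by nlinarith
      have := nonneg_of_mul_nonneg_right k3 (by linarith)
      linarith
    calc _ ≤ ∫⁻ x in {ξ | L ξ < ENNReal.ofReal t},
            ((Metric.closedBall (0 : E) R).indicator (fun x => ‖g x‖ₑ) x +
            ENNReal.ofReal ν * (‖x‖ₑ ^ β * ‖g x‖ₑ) ^ p) :=
          setLIntegral_mono' hs fun x hx => hpt x hx
      _ ≤ _ := setLIntegral_le_lintegral _ _
      _ = (∫⁻ x in Metric.closedBall (0 : E) R, ‖g x‖ₑ) +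
            ENNReal.ofReal ν * ∫⁻ x, (‖x‖ₑ ^ β * ‖g x‖ₑ) ^ p := by
          rw [lintegral_add_right _ (by fun_prop), lintegral_indicator measurableSet_closedBall,
            lintegral_const_mul _ hHm]
      _ ≤ C₁ * ENNReal.ofReal R ^ (n / q) * 1 ^ (1 / p) + ENNReal.ofReal ν * 1 := by
          grw [hball]
          simp only [zero_mul, ENNReal.rpow_zero, mul_one]
          gcongr
          · exact (setLIntegral_le_lintegral _ _).trans hle
          · exact mul_le_of_le_one_right' hle
      _ = ENNReal.ofReal (t / 2) := by
          rw [ENNReal.one_rpow, mul_one, mul_one, ENNReal.ofReal_rpow_of_pos hR0, hR,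
            ← Real.rpow_mul hν0.le, show q / n * (n / q) = 1 by field_simp, Real.rpow_one,
            ← ENNReal.ofReal_coe_nnreal, ← ENNReal.ofReal_mul (by positivity),
            ← ENNReal.ofReal_add (by positivity) hν0.le, hν, hK]
          congr 1
          field_simp
  gcongr
  calc ∫⁻ x, ‖g x‖ₑ ^ (2 : ℝ) * L x ^ (q - 2)
      ≤ ∫⁻ x, ENNReal.ofReal K ^ (q - 2) * (‖x‖ₑ ^ β * ‖g x‖ₑ) ^ p := by
        refine lintegral_mono fun x => ?_
        simp only [hL]
        rw [ENNReal.mul_rpow_of_nonneg _ _ (by linarith), ← ENNReal.rpow_mul,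
          one_div_mul_cancel (by linarith), ENNReal.rpow_one,
          ENNReal.mul_rpow_of_nonneg _ _ hp0.le, ← ENNReal.rpow_mul]
        by_cases hg0 : g x = 0
        · simp [hg0]
        have : ‖g x‖ₑ ^ p = ‖g x‖ₑ ^ (2 : ℝ) * ‖g x‖ₑ ^ (p - 2) := by
          rw [← ENNReal.rpow_add _ _ (by simpa using hg0) enorm_ne_top]; congr 1; ring
        rw [this]
        exact le_of_eq (by ring)
    _ ≤ ENNReal.ofReal K ^ (q - 2) := by
        rw [lintegral_const_mul _ hHm]
        grw [hle]
        rw [mul_one]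

theorem continuous_fourier_of_integrable {g : E → ℂ} (h1 : Integrable g) : Continuous (𝓕 g) :=
  VectorFourier.fourierIntegral_continuous Real.continuous_fourierChar continuous_inner h1

theorem enorm_fourier_le_lintegral (g : E → ℂ) (x : E) : ‖𝓕 g x‖ₑ ≤ ∫⁻ y, ‖g y‖ₑ := by
  rw [Real.fourier_eq]
  refine (enorm_integral_le_lintegral_enorm _).trans (lintegral_mono fun y => ?_)
  rw [Circle.smul_def, enorm_smul, ← ofReal_norm (_ : ℂ), Circle.norm_coe,
    ENNReal.ofReal_one, one_mul]

theorem volume_closedBall_rpow {R : ℝ} (hR : 0 < R) {a : ℝ} (ha : 0 ≤ a) :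
    volume (Metric.closedBall (0 : E) R) ^ a =
      ENNReal.ofReal R ^ (Module.finrank ℝ E * a) * volume (Metric.ball (0 : E) 1) ^ a := by
  rw [Measure.addHaar_closedBall _ _ hR.le, ENNReal.mul_rpow_of_nonneg _ _ ha,
    ENNReal.ofReal_pow hR.le, ← ENNReal.rpow_natCast, ← ENNReal.rpow_mul]

/-- Pitt's inequality with the weight on the function side only. -/
theorem lintegral_fourier_rpow_le_of_weight [Nontrivial E] {p q β : ℝ} (hp1 : 1 < p) (hpq : p ≤ q)
    (hq : 2 ≤ q) (hβ0 : 0 ≤ β) (hβ : β = Module.finrank ℝ E * (1 - 1 / p - 1 / q)) :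
    ∃ C : ℝ≥0∞, C ≠ ⊤ ∧ ∀ g : E → ℂ, Measurable g → Integrable g → MemLp g 2 →
      ∫⁻ x, (‖x‖ₑ ^ β * ‖g x‖ₑ) ^ p ≤ 1 → ∫⁻ x, ‖𝓕 g x‖ₑ ^ q ≤ C := by
  have hn0 : (0 : ℝ) < Module.finrank ℝ E := by exact_mod_cast Module.finrank_pos
  rcases hq.eq_or_lt with rfl | hq
  · have hp2 : p = 2 := by
      refine le_antisymm hpq ?_
      rw [hβ] at hβ0
      have := nonneg_of_mul_nonneg_right hβ0 hn0
      have h2 : 1 / p ≤ 1 / 2 := by linarith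
      exact le_of_one_div_le_one_div (by linarith) h2
    subst hp2
    have : β = 0 := by rw [hβ]; norm_num
    subst this
    refine ⟨1, by simp, fun g hgm hg1 hg2 hle => ?_⟩
    rw [lintegral_enorm_fourier_sq_eq hg1 hg2]
    simpa using hle
  · rcases le_or_gt 2 p with hp | hp
    · exact lintegral_fourier_rpow_le_of_two_le hp hpq hq hβ
    · exact lintegral_fourier_rpow_le_of_lt_two hp1 hp hq hβ0 hβ

theorem eLpNorm'_fourier_closedBall_le_of_le_one [Nontrivial E] {p q δ : ℝ} (hp1 : 1 ≤ p)
    (hpq : p ≤ q) (hδ : δ = Module.finrank ℝ E * (1 / p + 1 / q - 1)) :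
    ∃ C : ℝ≥0∞, C ≠ ⊤ ∧ ∀ g : E → ℂ, Measurable g → Integrable g → MemLp g 2 →
      ∫⁻ x, (‖x‖ₑ ^ (max (-δ) 0) * ‖g x‖ₑ) ^ p ≤ 1 → ∀ R : ℝ, 0 < R →
      eLpNorm' (𝓕 g) q (volume.restrict (Metric.closedBall (0 : E) R)) ≤
        C * ENNReal.ofReal R ^ (max δ 0) := by
  have hn0 : (0 : ℝ) < Module.finrank ℝ E := by exact_mod_cast Module.finrank_pos
  have hp0 : 0 < p := by linarith
  have hq0 : 0 < q := by linarith
  have hV : volume (Metric.ball (0 : E) 1) ≠ ⊤ := measure_ball_lt_top.ne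
  rcases le_or_gt δ 0 with hδ0 | hδ0
  · have hsum : 1 / p + 1 / q ≤ 1 := by
      rw [hδ] at hδ0
      have := nonpos_of_mul_nonpos_right hδ0 hn0
      linarith
    have hqp : 1 / q ≤ 1 / p := one_div_le_one_div_of_le hp0 hpq
    have hq2 : 2 ≤ q := by
      have : 1 / q ≤ 1 / 2 := by linarith
      exact le_of_one_div_le_one_div hq0 this
    have hp1' : 1 < p := by
      have : 0 < 1 / q := by positivity
      have h : 1 / p < 1 / 1 := by linarith
      exact lt_of_one_div_lt_one_div hp0 h
    obtain ⟨C, hC, h⟩ := lintegral_fourier_rpow_le_of_weight (E := E) hp1' hpq hq2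
      (β := -δ) (by linarith) (by rw [hδ]; ring)
    refine ⟨C ^ (1 / q), ENNReal.rpow_ne_top_of_nonneg (by positivity) hC,
      fun g hgm hg1 hg2 hle R hR => ?_⟩
    rw [max_eq_left (by linarith)] at hle
    rw [max_eq_right hδ0, ENNReal.rpow_zero, mul_one]
    refine (eLpNorm'_mono_measure _ Measure.restrict_le_self hq0.le).trans ?_
    rw [eLpNorm'_eq_lintegral_enorm]
    gcongr
    exact h g hgm hg1 hg2 hle
  · rw [max_eq_right (by linarith : -δ ≤ 0), max_eq_left hδ0.le]
    have hsum : 1 < 1 / p + 1 / q := by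
      rw [hδ] at hδ0
      have := pos_of_mul_pos_right hδ0 hn0.le
      linarith
    have hV' : volume (Metric.ball (0 : E) 1) ^ (1 / p + 1 / q - 1) ≠ ⊤ :=
      ENNReal.rpow_ne_top_of_nonneg (by linarith) hV
    rcases hp1.eq_or_lt with rfl | hp1
    · refine ⟨volume (Metric.ball (0 : E) 1) ^ (1 / 1 + 1 / q - 1), hV',
        fun g hgm hg1 hg2 hle R hR => ?_⟩
      simp only [ENNReal.rpow_zero, one_mul, ENNReal.rpow_one] at hle
      have hb : ∀ x, ‖𝓕 g x‖ₑ ≤ 1 := fun x => (enorm_fourier_le_lintegral g x).trans hle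
      calc eLpNorm' (𝓕 g) q (volume.restrict (Metric.closedBall (0 : E) R))
          ≤ (∫⁻ x in Metric.closedBall (0 : E) R, 1) ^ (1 / q) := by
            rw [eLpNorm'_eq_lintegral_enorm]
            gcongr with x
            exact ENNReal.rpow_le_one (hb x) hq0.le
        _ = _ := by
            rw [setLIntegral_const, one_mul, volume_closedBall_rpow hR (by positivity),
              mul_comm, hδ]
            congr 2 <;> norm_num
    · have hp' : 0 < 1 - 1 / p := by
        have : 1 / p < 1 / 1 := one_div_lt_one_div_of_lt one_pos hp1
        linarith
      set r := 1 / (1 - 1 / p) with hr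
      have hr1 : 1 / r = 1 - 1 / p := by rw [hr, one_div_one_div]
      have hr0 : 0 < r := by positivity
      have hqr : q ≤ r := by
        refine le_of_one_div_le_one_div hr0 ?_
        rw [hr1]; linarith
      have hp2 : p ≤ 2 := by
        have hqp : 1 / q ≤ 1 / p := one_div_le_one_div_of_le hp0 hpq
        have : 1 / 2 ≤ 1 / p := by linarith
        exact le_of_one_div_le_one_div two_pos this
      have hr2 : 2 ≤ r := by
        refine le_of_one_div_le_one_div hr0 ?_
        rw [hr1]
        have := one_div_le_one_div_of_le hp0 hp2
        linarith
      obtain ⟨C, hC, h⟩ := lintegral_fourier_rpow_le_of_weight (E := E) hp1 (hpq.trans hqr) hr2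
        (β := 0) le_rfl (by rw [hr1]; ring)
      refine ⟨C ^ (1 / r) * volume (Metric.ball (0 : E) 1) ^ (1 / p + 1 / q - 1), ?_,
        fun g hgm hg1 hg2 hle R hR => ?_⟩
      · have : C ^ (1 / r) ≠ ⊤ := ENNReal.rpow_ne_top_of_nonneg (by positivity) hC
        finiteness
      refine (eLpNorm'_le_eLpNorm'_mul_rpow_measure_univ hq0 hqr
        (continuous_fourier_of_integrable hg1).aestronglyMeasurable).trans ?_
      rw [Measure.restrict_apply_univ, hr1,
        show 1 / q - (1 - 1 / p) = 1 / p + 1 / q - 1 by ring,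
        volume_closedBall_rpow hR (by linarith), ← hδ]
      have : eLpNorm' (𝓕 g) r (volume.restrict (Metric.closedBall (0 : E) R)) ≤ C ^ (1 / r) := by
        refine (eLpNorm'_mono_measure _ Measure.restrict_le_self hr0.le).trans ?_
        rw [eLpNorm'_eq_lintegral_enorm]
        gcongr
        exact h g hgm hg1 hg2 hle
      rw [hr1] at this
      grw [this]
      exact le_of_eq (by ring)

theorem eLpNorm'_fourier_closedBall_le [Nontrivial E] {p q δ : ℝ} (hp1 : 1 ≤ p)
    (hpq : p ≤ q) (hδ : δ = Module.finrank ℝ E * (1 / p + 1 / q - 1)) :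
    ∃ C : ℝ≥0∞, C ≠ ⊤ ∧ ∀ g : E → ℂ, Measurable g → Integrable g → MemLp g 2 → ∀ M : ℝ, 0 < M →
      ∫⁻ x, (‖x‖ₑ ^ (max (-δ) 0) * ‖g x‖ₑ) ^ p ≤ ENNReal.ofReal M ^ p → ∀ R : ℝ, 0 < R →
      eLpNorm' (𝓕 g) q (volume.restrict (Metric.closedBall (0 : E) R)) ≤
        C * ENNReal.ofReal R ^ (max δ 0) * ENNReal.ofReal M := by
  have hp0 : 0 < p := by linarith
  have hq0 : 0 < q := by linarith
  obtain ⟨C, hC, h⟩ := eLpNorm'_fourier_closedBall_le_of_le_one (E := E) hp1 hpq hδ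
  refine ⟨C, hC, fun g hgm hg1 hg2 M hM hle R hR => ?_⟩
  set g₁ : E → ℂ := ((M : ℂ)⁻¹) • g with hg₁
  have hMC : (M : ℂ) ≠ 0 := by exact_mod_cast hM.ne'
  have hMe : ‖(M : ℂ)‖ₑ = ENNReal.ofReal M := by
    rw [← ofReal_norm, Complex.norm_real, Real.norm_of_nonneg hM.le]
  have hM0 : ENNReal.ofReal M ≠ 0 := by simpa using hM
  have key := h g₁ (hgm.const_smul _) (hg1.smul _) (hg2.const_smul _) ?_ R hR
  · have hF : 𝓕 g = (M : ℂ) • 𝓕 g₁ := by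
      have := VectorFourier.fourierIntegral_const_smul Real.fourierChar volume (innerₗ E) g₁ (M : ℂ)
      rw [hg₁, smul_smul, mul_inv_cancel₀ hMC, one_smul] at this
      exact this
    rw [hF, eLpNorm'_const_smul _ hq0, hMe]
    grw [key]
    exact le_of_eq (by ring)
  · calc _ = ∫⁻ x, (ENNReal.ofReal M)⁻¹ ^ p * (‖x‖ₑ ^ (max (-δ) 0) * ‖g x‖ₑ) ^ p := by
          congr with x
          rw [hg₁, Pi.smul_apply, enorm_smul, enorm_inv hMC, hMe,
            ← ENNReal.mul_rpow_of_nonneg _ _ hp0.le]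
          congr 1
          ring
      _ = (ENNReal.ofReal M)⁻¹ ^ p * ∫⁻ x, (‖x‖ₑ ^ (max (-δ) 0) * ‖g x‖ₑ) ^ p :=
          lintegral_const_mul _ (by fun_prop)
      _ ≤ (ENNReal.ofReal M)⁻¹ ^ p * ENNReal.ofReal M ^ p := by gcongr
      _ = 1 := by
          rw [← ENNReal.mul_rpow_of_nonneg _ _ hp0.le,
            ENNReal.inv_mul_cancel hM0 ENNReal.ofReal_ne_top, ENNReal.one_rpow]

theorem fourier_comp_inv_smul_sub (φ : E → ℂ) {t : ℝ} (ht : 0 < t) (x ξ : E) :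
    𝓕 (fun y => φ (t⁻¹ • (y - x))) ξ =
      ((Real.fourierChar (-inner ℝ x ξ) : Circle) : ℂ) * ((t ^ Module.finrank ℝ E : ℝ) : ℂ) *
        𝓕 φ (t • ξ) := by
  rw [Real.fourier_eq, Real.fourier_eq]
  calc _ = ∫ y, Real.fourierChar (-inner ℝ (y + x) ξ) • φ (t⁻¹ • y) := by
        rw [← integral_add_right_eq_self _ x]
        simp
    _ = ∫ y, (fun z => Real.fourierChar (-inner ℝ (t • z + x) ξ) • φ z) (t⁻¹ • y) := by
        simp [smul_smul, ht.ne']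
    _ = (t ^ Module.finrank ℝ E : ℝ) •
          ∫ z, Real.fourierChar (-inner ℝ (t • z + x) ξ) • φ z := by
        rw [Measure.integral_comp_smul_of_nonneg volume
          (fun z => Real.fourierChar (-inner ℝ (t • z + x) ξ) • φ z) t⁻¹
          (hR := inv_nonneg.2 ht.le), inv_pow, inv_inv]
    _ = _ := by
        rw [Complex.real_smul, mul_comm ((Real.fourierChar _ : Circle) : ℂ), mul_assoc]
        congr 1
        rw [← integral_const_mul]
        refine integral_congr_ae (Filter.Eventually.of_forall fun z => ?_)
        simp only
        rw [inner_add_left, real_inner_smul_left, real_inner_smul_right, neg_add,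
          AddChar.map_add_eq_mul, Circle.smul_def, Circle.smul_def, Circle.coe_mul, smul_eq_mul,
          smul_eq_mul]
        ring

theorem fourier_comp_inv_smul (φ : E → ℂ) {t : ℝ} (ht : 0 < t) (ξ : E) :
    𝓕 (fun y => φ (t⁻¹ • y)) ξ =
      ((t ^ Module.finrank ℝ E : ℝ) : ℂ) * 𝓕 φ (t • ξ) := by
  simpa using fourier_comp_inv_smul_sub φ ht 0 ξ

theorem lintegral_comp_inv_smul_sub (F : E → ℝ≥0∞) {t : ℝ} (ht : 0 < t) (x : E) :
    ∫⁻ y, F (t⁻¹ • (y - x)) = ENNReal.ofReal (t ^ Module.finrank ℝ E) * ∫⁻ y, F y := by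
  rw [lintegral_sub_right_eq_self (fun y => F (t⁻¹ • y)) x,
    lintegral_eq_mul_lintegral_comp_smul _ ht]
  simp [smul_smul, ht.ne']

/-- A smooth frequency cut-off at scale `1 / t` maps `L^q` to `L^∞` with norm `O(t^{-d/q})`. -/
theorem enorm_fourier_cutoff_mul_le (χ : SchwartzMap E ℂ) {q : ℝ} (hq : 1 ≤ q) :
    ∃ C : ℝ≥0∞, C ≠ ⊤ ∧ ∀ G : SchwartzMap E ℂ, ∀ t : ℝ, 0 < t → ∀ x : E,
      ‖𝓕 (fun ξ => χ (t • ξ) * G ξ) x‖ₑ ≤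
        C * ENNReal.ofReal t ^ (-(Module.finrank ℝ E / q : ℝ)) * eLpNorm' (𝓕 (⇑G)) q volume := by
  have hq0 : 0 < q := by linarith
  have hq1 : 0 ≤ 1 - 1 / q := by
    have := one_div_le_one_div_of_le one_pos hq
    linarith
  set K : SchwartzMap E ℂ := 𝓕⁻ χ with hK
  have hKχ : 𝓕 (⇑K) = ⇑χ := by
    rw [← SchwartzMap.fourier_coe, hK, FourierTransform.fourier_fourierInv_eq]
  set S : ℝ := SchwartzMap.seminorm ℝ 0 0 K with hS
  have hKS : ∀ y, ‖K y‖ₑ ≤ ENNReal.ofReal S := fun y => by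
    rw [← ofReal_norm]
    exact ENNReal.ofReal_le_ofReal (SchwartzMap.norm_le_seminorm ℝ K y)
  set I : ℝ≥0∞ := ∫⁻ y, ‖K y‖ₑ with hI
  have hItop : I ≠ ⊤ := K.integrable.2.ne
  refine ⟨ENNReal.ofReal S ^ (1 / q) * I ^ (1 - 1 / q), ?_, fun G t ht x => ?_⟩
  · have h1 : ENNReal.ofReal S ^ (1 / q) ≠ ⊤ :=
      ENNReal.rpow_ne_top_of_nonneg (by positivity) ENNReal.ofReal_ne_top
    have h2 : I ^ (1 - 1 / q) ≠ ⊤ := ENNReal.rpow_ne_top_of_nonneg hq1 hItop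
    finiteness
  set n := Module.finrank ℝ E with hn
  set T : ℝ≥0∞ := ENNReal.ofReal (t ^ n) with hT
  have hT0 : T ≠ 0 := by simp only [hT, ne_eq, ENNReal.ofReal_eq_zero, not_le]; positivity
  have hTtop : T ≠ ⊤ := ENNReal.ofReal_ne_top
  have htC : ((t ^ n : ℝ) : ℂ) ≠ 0 := by exact_mod_cast (pow_pos ht n).ne'
  set h : E → ℂ := fun y => ((t ^ n : ℝ) : ℂ)⁻¹ * K (t⁻¹ • (y - x)) with hh
  have hhm : Continuous h := by
    have := K.continuous
    fun_prop
  have hnorm : ∀ y, ‖h y‖ₑ = T⁻¹ * ‖K (t⁻¹ • (y - x))‖ₑ := fun y => by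
    rw [hh]
    simp only
    rw [enorm_mul, enorm_inv htC, ← ofReal_norm ((t ^ n : ℝ) : ℂ), Complex.norm_real,
      Real.norm_of_nonneg (by positivity)]
  have hhI : ∫⁻ y, ‖h y‖ₑ = I := by
    simp_rw [hnorm]
    rw [lintegral_const_mul' _ _ (ENNReal.inv_ne_top.2 hT0),
      lintegral_comp_inv_smul_sub (fun y => ‖K y‖ₑ) ht, ← mul_assoc,
      ENNReal.inv_mul_cancel hT0 hTtop, one_mul]
  have hhint : Integrable h := ⟨hhm.aestronglyMeasurable, by
    rw [HasFiniteIntegral, hhI]; exact hItop.lt_top⟩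
  have hhF : ∀ ξ, 𝓕 h ξ = ((Real.fourierChar (-inner ℝ x ξ) : Circle) : ℂ) * χ (t • ξ) := by
    intro ξ
    have e := VectorFourier.fourierIntegral_const_smul Real.fourierChar volume (innerₗ E)
      (fun y => K (t⁻¹ • (y - x))) (((t ^ n : ℝ) : ℂ)⁻¹)
    have e2 : 𝓕 h ξ = ((t ^ n : ℝ) : ℂ)⁻¹ * 𝓕 (fun y => K (t⁻¹ • (y - x))) ξ := congrFun e ξ
    rw [e2, fourier_comp_inv_smul_sub _ ht, hKχ, ← hn]
    field_simp
  have hkey : 𝓕 (fun ξ => χ (t • ξ) * G ξ) x = ∫ y, h y • 𝓕 (⇑G) y := by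
    rw [← integral_fourier_smul_eq_of_integrable hhint G.integrable, Real.fourier_eq]
    congr with ξ
    rw [hhF, Circle.smul_def, smul_eq_mul, smul_eq_mul, real_inner_comm]
    ring
  have hFm : Continuous (𝓕 (⇑G)) := continuous_fourier_of_integrable G.integrable
  set ν := (volume : Measure E).withDensity fun y => ‖h y‖ₑ with hν
  have hν1 : ν Set.univ = I := by
    rw [hν, withDensity_apply _ MeasurableSet.univ, Measure.restrict_univ, hhI]
  have hνi : ∀ F : E → ℝ≥0∞, Measurable F → ∫⁻ y, F y ∂ν = ∫⁻ y, ‖h y‖ₑ * F y := fun F hF =>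
    lintegral_withDensity_eq_lintegral_mul _ hhm.measurable.enorm hF
  calc ‖𝓕 (fun ξ => χ (t • ξ) * G ξ) x‖ₑ ≤ ∫⁻ y, ‖h y‖ₑ * ‖𝓕 (⇑G) y‖ₑ := by
        rw [hkey]
        refine (enorm_integral_le_lintegral_enorm _).trans_eq ?_
        simp_rw [enorm_smul]
    _ = eLpNorm' (𝓕 (⇑G)) 1 ν := by
        rw [eLpNorm'_eq_lintegral_enorm]
        simp only [ENNReal.rpow_one, div_one]
        rw [hνi _ hFm.measurable.enorm]
    _ ≤ eLpNorm' (𝓕 (⇑G)) q ν * ν Set.univ ^ (1 / 1 - 1 / q) :=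
        eLpNorm'_le_eLpNorm'_mul_rpow_measure_univ one_pos hq hFm.aestronglyMeasurable
    _ ≤ (ENNReal.ofReal S ^ (1 / q) * ENNReal.ofReal t ^ (-(n / q : ℝ)) *
          eLpNorm' (𝓕 (⇑G)) q volume) * I ^ (1 - 1 / q) := by
        rw [hν1, one_div_one]
        gcongr
        rw [eLpNorm'_eq_lintegral_enorm, eLpNorm'_eq_lintegral_enorm,
          hνi _ (hFm.measurable.enorm.pow_const _)]
        have hTt : ENNReal.ofReal t ^ (-(n / q : ℝ)) = T⁻¹ ^ (1 / q) := by
          rw [hT, ENNReal.ofReal_pow ht.le, ← ENNReal.rpow_natCast, ← ENNReal.rpow_neg,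
            ← ENNReal.rpow_mul]
          congr 1
          ring
        rw [hTt, ← ENNReal.mul_rpow_of_nonneg _ _ (by positivity),
          ← ENNReal.mul_rpow_of_nonneg _ _ (by positivity)]
        gcongr
        rw [← lintegral_const_mul _ (hFm.measurable.enorm.pow_const _)]
        gcongr with y
        rw [hnorm, mul_comm]
        gcongr
        exact hKS _
    _ = _ := by ring

theorem exists_schwartz_cutoff {V : Type*} [NormedAddCommGroup V] [InnerProductSpace ℝ V]
    [FiniteDimensional ℝ V] : ∃ χ : SchwartzMap V ℂ, (∀ x, ‖x‖ ≤ 1 → χ x = 1) ∧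
    ∀ x, ‖1 - χ x‖ ≤ 1 := by
  let b : ContDiffBump (0 : V) := ⟨1, 2, one_pos, one_lt_two⟩
  have h1 : HasCompactSupport (Complex.ofRealCLM ∘ b) := b.hasCompactSupport.comp_left rfl
  have h2 : ContDiff ℝ (⊤ : ℕ∞) (Complex.ofRealCLM ∘ b) :=
    Complex.ofRealCLM.contDiff.comp b.contDiff
  refine ⟨h1.toSchwartzMap h2, fun x hx => ?_, fun x => ?_⟩
  · have : b x = 1 := b.one_of_mem_closedBall (by simpa [b] using hx)
    simp [this]
  · have hx0 := b.nonneg (x := x)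
    have hx1 := b.le_one (x := x)
    have : (1 : ℂ) - (b x : ℂ) = ((1 - b x : ℝ) : ℂ) := by push_cast; rfl
    simp only [HasCompactSupport.toSchwartzMap_toFun, Function.comp_apply, Complex.ofRealCLM_apply]
    rw [this, Complex.norm_real, Real.norm_of_nonneg (by linarith)]
    linarith

theorem eLpNorm'_le_add_compl {α : Type*} [MeasurableSpace α] {μ : Measure α} (F : α → ℂ) {q : ℝ}
    (hq : 1 ≤ q) {s : Set α} (hs : MeasurableSet s) :
    eLpNorm' F q μ ≤ eLpNorm' F q (μ.restrict s) + eLpNorm' F q (μ.restrict sᶜ) := by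
  simp only [eLpNorm'_eq_lintegral_enorm]
  rw [← lintegral_add_compl _ hs]
  refine ENNReal.rpow_add_le_add_rpow _ _ (by positivity) ?_
  rw [div_le_one (by linarith)]
  exact hq

theorem ENNReal.le_two_mul_of_le_half_add {N X : ℝ≥0∞} (hN : N ≠ ⊤) (h : N ≤ N / 2 + X) :
    N ≤ 2 * X := by
  have h2 : N / 2 ≤ X := by
    have h' : N / 2 + N / 2 ≤ N / 2 + X := by rwa [ENNReal.add_halves]
    exact (ENNReal.add_le_add_iff_left (ENNReal.div_ne_top hN two_ne_zero)).1 h'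
  calc N = N / 2 + N / 2 := (ENNReal.add_halves N).symm
    _ ≤ X + X := add_le_add h2 h2
    _ = 2 * X := (two_mul X).symm

/-- A quantitative uncertainty principle: high-frequency smallness controls the `L^q` mass
near the origin, so the full norm is controlled by the mass away from the origin. -/
theorem eLpNorm'_fourier_le_of_high_frequency [Nontrivial E] {p q δ : ℝ} (hp1 : 1 ≤ p)
    (hpq : p ≤ q) (hδ : δ = Module.finrank ℝ E * (1 / p + 1 / q - 1)) :
    ∃ κ : ℝ, 0 < κ ∧ κ ≤ 1 ∧ ∃ C : ℝ≥0∞, C ≠ ⊤ ∧ ∀ G : SchwartzMap E ℂ,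
      ∀ t : ℝ, 0 < t → ∀ M : ℝ, 0 < M →
      ∫⁻ x in {x : E | t⁻¹ ≤ ‖x‖}, (‖x‖ₑ ^ (max (-δ) 0) * ‖G x‖ₑ) ^ p ≤ ENNReal.ofReal M ^ p →
      eLpNorm' (𝓕 (⇑G)) q volume ≤ C * ENNReal.ofReal t ^ (max δ 0) * ENNReal.ofReal M +
        2 * eLpNorm' (𝓕 (⇑G)) q (volume.restrict (Metric.closedBall (0 : E) (κ * t))ᶜ) := by
  have hn0 : (0 : ℝ) < Module.finrank ℝ E := by exact_mod_cast Module.finrank_pos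
  have hp0 : 0 < p := by linarith
  have hq0 : 0 < q := by linarith
  obtain ⟨χ, hχ1, hχ⟩ := exists_schwartz_cutoff (V := E)
  obtain ⟨C₁, hC₁, hlow⟩ := enorm_fourier_cutoff_mul_le χ (hp1.trans hpq)
  obtain ⟨C₂, hC₂, hhigh⟩ := eLpNorm'_fourier_closedBall_le (E := E) hp1 hpq hδ
  set n := Module.finrank ℝ E with hn
  set V := volume (Metric.ball (0 : E) 1) ^ (1 / q) with hV
  have hVtop : V ≠ ⊤ := ENNReal.rpow_ne_top_of_nonneg (by positivity) measure_ball_lt_top.ne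
  set c := (C₁ * V).toReal with hc
  have hc0 : 0 ≤ c := ENNReal.toReal_nonneg
  have hcC : C₁ * V = ENNReal.ofReal c := by
    rw [hc, ENNReal.ofReal_toReal (by finiteness)]
  set κ : ℝ := (2 * (c + 1)) ^ (-(q / n)) with hκ
  have hκ0 : 0 < κ := by positivity
  have hκ1 : κ ≤ 1 := Real.rpow_le_one_of_one_le_of_nonpos (by linarith)
    (neg_nonpos.2 (by positivity))
  have hκn : κ ^ (n * (1 / q) : ℝ) = (2 * (c + 1))⁻¹ := by
    rw [hκ, ← Real.rpow_mul (by positivity), show -(q / n : ℝ) * (n * (1 / q)) = -1 by field_simp,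
      Real.rpow_neg_one]
  have hhalf : C₁ * V * ENNReal.ofReal κ ^ (n * (1 / q) : ℝ) ≤ 2⁻¹ := by
    rw [hcC, ENNReal.ofReal_rpow_of_pos hκ0, hκn, ← ENNReal.ofReal_mul hc0,
      show (2⁻¹ : ℝ≥0∞) = ENNReal.ofReal 2⁻¹ by
        rw [ENNReal.ofReal_inv_of_pos two_pos, ENNReal.ofReal_ofNat]]
    apply ENNReal.ofReal_le_ofReal
    rw [← div_eq_mul_inv, div_le_iff₀ (by positivity)]
    linarith
  refine ⟨κ, hκ0, hκ1, 2 * C₂ * ENNReal.ofReal κ ^ (max δ 0), ?_, fun G t ht M hM hle => ?_⟩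
  · have : ENNReal.ofReal κ ^ (max δ 0) ≠ ⊤ :=
      ENNReal.rpow_ne_top_of_nonneg (le_max_right _ _) ENNReal.ofReal_ne_top
    finiteness
  set F := 𝓕 (⇑G) with hF
  set N := eLpNorm' F q volume with hN
  have hNtop : N ≠ ⊤ := by
    have h := (𝓕 G).memLp (ENNReal.ofReal q) volume
    have h2 := h.2
    rw [eLpNorm_eq_eLpNorm' (by simpa using hq0) ENNReal.ofReal_ne_top,
      ENNReal.toReal_ofReal hq0.le] at h2
    exact h2.ne
  set g₁ : E → ℂ := fun ξ => χ (t • ξ) * G ξ with hg₁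
  set g₂ : E → ℂ := fun ξ => (1 - χ (t • ξ)) * G ξ with hg₂
  have hχc := χ.continuous
  have hGc := G.continuous
  have hg₁c : Continuous g₁ := by fun_prop
  have hg₂c : Continuous g₂ := by fun_prop
  have hg₂le : ∀ ξ, ‖g₂ ξ‖ ≤ ‖G ξ‖ := fun ξ => by
    rw [hg₂, norm_mul]
    exact mul_le_of_le_one_left (norm_nonneg _) (hχ _)
  have hg₂i : Integrable g₂ := G.integrable.mono hg₂c.aestronglyMeasurable
    (Filter.Eventually.of_forall hg₂le)
  have hg₂m : MemLp g₂ 2 := (G.memLp 2 volume).mono hg₂c.aestronglyMeasurable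
    (Filter.Eventually.of_forall hg₂le)
  have hadd : (⇑G) = g₁ + g₂ := by
    ext ξ
    simp only [hg₁, hg₂, Pi.add_apply]
    ring
  have hg₁i : Integrable g₁ := by
    have : g₁ = ⇑G - g₂ := by rw [hadd]; simp
    rw [this]
    exact G.integrable.sub hg₂i
  have hFadd : F = 𝓕 g₁ + 𝓕 g₂ := by
    have := VectorFourier.fourierIntegral_add (μ := volume) (L := innerₗ E)
      Real.continuous_fourierChar continuous_inner hg₁i hg₂i
    rw [← hadd] at this
    exact this
  have hg₂w : ∫⁻ x, (‖x‖ₑ ^ (max (-δ) 0) * ‖g₂ x‖ₑ) ^ p ≤ ENNReal.ofReal M ^ p := by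
    refine le_trans ?_ hle
    have hs : MeasurableSet {x : E | t⁻¹ ≤ ‖x‖} := measurableSet_le measurable_const measurable_norm
    rw [← lintegral_indicator hs]
    refine lintegral_mono fun x => ?_
    by_cases hx : t⁻¹ ≤ ‖x‖
    · rw [Set.indicator_of_mem (by exact hx)]
      gcongr
      exact enorm_le_iff_norm_le.2 (hg₂le x)
    · have : χ (t • x) = 1 := hχ1 _ (by
        rw [norm_smul, Real.norm_of_nonneg ht.le]
        calc t * ‖x‖ ≤ t * t⁻¹ := by gcongr; exact (not_le.1 hx).le
          _ = 1 := mul_inv_cancel₀ ht.ne')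
      simp [hg₂, this, hp0]
  have hκt : 0 < κ * t := by positivity
  set B := Metric.closedBall (0 : E) (κ * t) with hB
  have b1 : eLpNorm' (𝓕 g₁) q (volume.restrict B) ≤ N / 2 := by
    calc _ ≤ eLpNorm' (fun _ : E => C₁ * ENNReal.ofReal t ^ (-(n / q : ℝ)) * N) q
            (volume.restrict B) :=
          eLpNorm'_mono_enorm_ae hq0.le (Filter.Eventually.of_forall fun x => by
            simpa using hlow G t ht x)
      _ = C₁ * ENNReal.ofReal t ^ (-(n / q : ℝ)) * N * volume B ^ (1 / q) := by
          rw [eLpNorm'_const _ hq0, Measure.restrict_apply_univ]; simp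
      _ = (C₁ * V * ENNReal.ofReal κ ^ (n * (1 / q) : ℝ)) * N *
            (ENNReal.ofReal t ^ (-(n / q : ℝ)) * ENNReal.ofReal t ^ (n / q : ℝ)) := by
          rw [hB, volume_closedBall_rpow hκt (by positivity), ENNReal.ofReal_mul hκ0.le,
            ENNReal.mul_rpow_of_nonneg _ _ (by positivity), ← hn, mul_one_div (n : ℝ)]
          ring
      _ ≤ 2⁻¹ * N * 1 := by
          gcongr
          rw [← ENNReal.rpow_add _ _ (by simpa using ht) ENNReal.ofReal_ne_top, neg_add_cancel,
            ENNReal.rpow_zero]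
      _ = N / 2 := by rw [mul_one, div_eq_mul_inv, mul_comm]
  have b2 := hhigh g₂ hg₂c.measurable hg₂i hg₂m M hM hg₂w (κ * t) hκt
  have hsum : N ≤ N / 2 + (C₂ * ENNReal.ofReal (κ * t) ^ (max δ 0) * ENNReal.ofReal M +
      eLpNorm' F q (volume.restrict Bᶜ)) := by
    calc N ≤ eLpNorm' F q (volume.restrict B) + eLpNorm' F q (volume.restrict Bᶜ) :=
          eLpNorm'_le_add_compl F (hp1.trans hpq) measurableSet_closedBall
      _ ≤ (eLpNorm' (𝓕 g₁) q (volume.restrict B) + eLpNorm' (𝓕 g₂) q (volume.restrict B)) +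
            eLpNorm' F q (volume.restrict Bᶜ) := by
          gcongr
          rw [hFadd]
          exact eLpNorm'_add_le (continuous_fourier_of_integrable hg₁i).aestronglyMeasurable
            (continuous_fourier_of_integrable hg₂i).aestronglyMeasurable (hp1.trans hpq)
      _ ≤ _ := by
          grw [b1, b2]
          rw [add_assoc]
  refine (ENNReal.le_two_mul_of_le_half_add hNtop hsum).trans_eq ?_
  rw [ENNReal.ofReal_mul hκ0.le, ENNReal.mul_rpow_of_nonneg _ _ (le_max_right _ _)]
  ring

end Pitt

section BrokenWeight

variable {d : ℕ}

theorem brokenWeight_nonneg (A : ℝ × ℝ) (x : EuclideanSpace ℝ (Fin d)) : 0 ≤ brokenWeight A x := by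
  unfold brokenWeight
  split_ifs <;> positivity

theorem brokenWeight_neg (A : ℝ × ℝ) (x : EuclideanSpace ℝ (Fin d)) :
    brokenWeight A (-x) = brokenWeight A x := by
  simp [brokenWeight]

theorem norm_rpow_le_mul_brokenWeight {B : ℝ × ℝ} {β : ℝ} (hβB : β ≤ B.2)
    {t : ℝ} (ht : 0 < t) {x : EuclideanSpace ℝ (Fin d)} (hx : t⁻¹ ≤ ‖x‖) :
    ‖x‖ ^ β ≤ t ^ (if t < 1 then B.2 - β else max (B.1 - β) 0) * brokenWeight B x := by
  have hx0 : 0 < ‖x‖ := (inv_pos.2 ht).trans_le hx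
  have htx : 1 ≤ t * ‖x‖ := by rwa [inv_le_iff_one_le_mul₀' ht] at hx
  have key : ∀ b : ℝ, β ≤ b → ‖x‖ ^ β ≤ t ^ (b - β) * ‖x‖ ^ b := fun b hb => by
    calc ‖x‖ ^ β ≤ (t * ‖x‖) ^ (b - β) * ‖x‖ ^ β :=
          le_mul_of_one_le_left (by positivity) (Real.one_le_rpow htx (by linarith))
      _ = _ := by
          rw [Real.mul_rpow ht.le hx0.le, mul_assoc, ← Real.rpow_add hx0, sub_add_cancel]
  unfold brokenWeight
  split_ifs with h1 h2 h2
  · have : 1 < t⁻¹ := (one_lt_inv₀ ht).2 h1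
    linarith
  · exact key _ hβB
  · rcases le_total β B.1 with hb | hb
    · rw [max_eq_left (by linarith)]
      exact key _ hb
    · rw [max_eq_right (by linarith), Real.rpow_zero, one_mul]
      exact Real.rpow_le_rpow_of_exponent_ge hx0 h2.le hb
  · calc ‖x‖ ^ β ≤ ‖x‖ ^ B.2 := Real.rpow_le_rpow_of_exponent_le (not_lt.1 h2) hβB
      _ ≤ _ := le_mul_of_one_le_left (by positivity)
          (Real.one_le_rpow (not_lt.1 h1) (le_max_right _ _))

theorem mul_rpow_le_brokenWeight {A : ℝ × ℝ} (hA1 : 0 < A.1) (hA2 : 0 < A.2) {κ t : ℝ}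
    (hκ : 0 < κ) (hκ1 : κ ≤ 1) (ht : 0 < t) {x : EuclideanSpace ℝ (Fin d)} (hx : κ * t ≤ ‖x‖) :
    κ ^ (A.1 + A.2) * t ^ (if t < 1 then A.1 else A.2) ≤ brokenWeight A x := by
  have hκA1 : κ ^ A.1 ≤ 1 := Real.rpow_le_one hκ.le hκ1 hA1.le
  have hκA2 : κ ^ A.2 ≤ 1 := Real.rpow_le_one hκ.le hκ1 hA2.le
  have hκt : 0 < κ * t := by positivity
  rw [Real.rpow_add hκ]
  unfold brokenWeight
  split_ifs with h1 h2 h2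
  · calc κ ^ A.1 * κ ^ A.2 * t ^ A.1 = κ ^ A.2 * (κ * t) ^ A.1 := by
          rw [Real.mul_rpow hκ.le ht.le]; ring
      _ ≤ 1 * ‖x‖ ^ A.1 := by gcongr
      _ = _ := one_mul _
  · have : t ^ A.1 ≤ 1 := Real.rpow_le_one ht.le h1.le hA1.le
    calc κ ^ A.1 * κ ^ A.2 * t ^ A.1 ≤ 1 * 1 * 1 := by gcongr
      _ ≤ _ := by simpa using Real.one_le_rpow (not_lt.1 h2) hA2.le
  · have hle : (κ * t) ^ A.2 ≤ 1 := Real.rpow_le_one hκt.le (by linarith) hA2.le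
    calc κ ^ A.1 * κ ^ A.2 * t ^ A.2 = κ ^ A.1 * (κ * t) ^ A.2 := by
          rw [Real.mul_rpow hκ.le ht.le]; ring
      _ ≤ κ ^ A.1 * t ^ A.1 := by
          gcongr
          exact hle.trans (Real.one_le_rpow (not_lt.1 h1) hA1.le)
      _ = (κ * t) ^ A.1 := (Real.mul_rpow hκ.le ht.le).symm
      _ ≤ _ := by gcongr
  · calc κ ^ A.1 * κ ^ A.2 * t ^ A.2 = κ ^ A.1 * (κ * t) ^ A.2 := by
          rw [Real.mul_rpow hκ.le ht.le]; ring
      _ ≤ 1 * ‖x‖ ^ A.2 := by gcongr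
      _ = _ := one_mul _

/-- Upper bound with a free scale `t`. -/
theorem eLpNorm'_le_of_brokenWeight [Nonempty (Fin d)] {p q δ : ℝ} (hp1 : 1 ≤ p) (hpq : p ≤ q)
    (hδ : δ = d * (1 / p + 1 / q - 1)) {A B : ℝ × ℝ} (hA1 : 0 < A.1) (hA2 : 0 < A.2)
    (hB1 : 0 < B.1) (hB2 : 0 < B.2) (hδB : -δ ≤ B.2) :
    ∃ C : ℝ, 0 < C ∧ ∀ f : SchwartzMap (EuclideanSpace ℝ (Fin d)) ℂ, ∀ x : ℝ, 0 < x →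
      eLpNorm' (fun y => brokenWeight A y * ‖f y‖) q volume ≤ ENNReal.ofReal x →
      eLpNorm' (fun ξ => brokenWeight B ξ * ‖𝓕 (⇑f) ξ‖) p volume ≤ 1 → ∀ t : ℝ, 0 < t →
      eLpNorm' (⇑f) q volume ≤ ENNReal.ofReal (C *
        (t ^ (if t < 1 then B.2 + δ else max (B.1 + δ) 0) +
          t ^ (-(if t < 1 then A.1 else A.2)) * x)) := by
  have hp0 : 0 < p := by linarith
  have hq0 : 0 < q := by linarith
  obtain ⟨κ, hκ, hκ1, C₁, hC₁, h⟩ := eLpNorm'_fourier_le_of_high_frequency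
    (E := EuclideanSpace ℝ (Fin d)) (δ := δ) hp1 hpq (by rwa [finrank_euclideanSpace_fin])
  lift C₁ to NNReal using hC₁
  set β := max (-δ) 0 with hβ
  have hβ0 : 0 ≤ β := le_max_right _ _
  have hβB : β ≤ B.2 := max_le hδB hB2.le
  set k := κ ^ (A.1 + A.2) with hk
  have hk0 : 0 < k := by positivity
  refine ⟨C₁ + 2 * k⁻¹, by positivity, fun f x hx hA hB t ht => ?_⟩
  set G : SchwartzMap (EuclideanSpace ℝ (Fin d)) ℂ := 𝓕⁻ f with hG
  have hGf : 𝓕 (⇑G) = ⇑f := by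
    rw [← SchwartzMap.fourier_coe, hG, FourierTransform.fourier_fourierInv_eq]
  have hGx : ∀ ξ, G ξ = 𝓕 (⇑f) (-ξ) := fun ξ => by
    rw [hG, SchwartzMap.fourierInv_coe, Real.fourierInv_eq_fourier_neg]
  set μ := if t < 1 then B.2 - β else max (B.1 - β) 0 with hμ
  set a := if t < 1 then A.1 else A.2 with ha
  have hBG : ∫⁻ ξ, (ENNReal.ofReal (brokenWeight B ξ) * ‖G ξ‖ₑ) ^ p ≤ 1 := by
    rw [eLpNorm'_eq_lintegral_enorm, one_div, ENNReal.rpow_inv_le_iff hp0, ENNReal.one_rpow,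
      ← lintegral_neg_eq_self] at hB
    refine le_trans (lintegral_mono fun ξ => ?_) hB
    simp only [hGx, brokenWeight_neg, enorm_mul, Real.enorm_of_nonneg (brokenWeight_nonneg _ _),
      enorm_norm]
    exact le_rfl
  have hμm : μ + max δ 0 = if t < 1 then B.2 + δ else max (B.1 + δ) 0 := by
    rw [hμ, hβ]
    rcases le_total δ 0 with h0 | h0
    · rw [max_eq_left (by linarith : 0 ≤ -δ), max_eq_right h0]
      split_ifs <;> simp
    · rw [max_eq_right (by linarith : -δ ≤ 0), max_eq_left h0, sub_zero, sub_zero,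
        max_eq_left hB1.le, max_eq_left (by linarith)]
      split_ifs <;> rfl
  have hhigh : ∫⁻ ξ in {ξ : EuclideanSpace ℝ (Fin d) | t⁻¹ ≤ ‖ξ‖}, (‖ξ‖ₑ ^ β * ‖G ξ‖ₑ) ^ p ≤
      ENNReal.ofReal (t ^ μ) ^ p := by
    calc _ ≤ ∫⁻ ξ in {ξ : EuclideanSpace ℝ (Fin d) | t⁻¹ ≤ ‖ξ‖},
          ENNReal.ofReal (t ^ μ) ^ p * (ENNReal.ofReal (brokenWeight B ξ) * ‖G ξ‖ₑ) ^ p := by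
          refine setLIntegral_mono' (measurableSet_le measurable_const measurable_norm)
            fun ξ hξ => ?_
          rw [← ENNReal.mul_rpow_of_nonneg _ _ hp0.le, ← mul_assoc,
            ← ENNReal.ofReal_mul (by positivity)]
          gcongr
          rw [← ofReal_norm, ENNReal.ofReal_rpow_of_nonneg (norm_nonneg _) hβ0]
          exact ENNReal.ofReal_le_ofReal (norm_rpow_le_mul_brokenWeight hβB ht hξ)
      _ ≤ _ := setLIntegral_le_lintegral _ _
      _ ≤ _ := by
          rw [lintegral_const_mul' _ _
            (ENNReal.rpow_ne_top_of_nonneg hp0.le ENNReal.ofReal_ne_top)]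
          exact mul_le_of_le_one_right' hBG
  have hout : eLpNorm' (⇑f) q (volume.restrict
      (Metric.closedBall (0 : EuclideanSpace ℝ (Fin d)) (κ * t))ᶜ) ≤
      ENNReal.ofReal (k⁻¹ * (t ^ (-a) * x)) := by
    calc _ ≤ eLpNorm' ((k⁻¹ * t ^ (-a)) • fun y => brokenWeight A y * ‖f y‖) q (volume.restrict
          (Metric.closedBall (0 : EuclideanSpace ℝ (Fin d)) (κ * t))ᶜ) := by
          refine eLpNorm'_mono_ae hq0.le ?_
          filter_upwards [ae_restrict_mem measurableSet_closedBall.compl] with y hy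
          have hy' : κ * t ≤ ‖y‖ := by
            simp only [Set.mem_compl_iff, Metric.mem_closedBall, dist_zero_right, not_le] at hy
            exact hy.le
          have hw := mul_rpow_le_brokenWeight hA1 hA2 hκ hκ1 ht hy'
          have hw0 := brokenWeight_nonneg A y
          rw [Pi.smul_apply, smul_eq_mul, Real.norm_of_nonneg (by positivity), ← mul_assoc]
          refine le_mul_of_one_le_left (norm_nonneg _) ?_
          calc (1 : ℝ) = k⁻¹ * t ^ (-a) * (k * t ^ a) := by
                rw [Real.rpow_neg ht.le]; field_simp
            _ ≤ _ := by gcongr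
      _ ≤ eLpNorm' ((k⁻¹ * t ^ (-a)) • fun y => brokenWeight A y * ‖f y‖) q volume :=
          eLpNorm'_mono_measure _ Measure.restrict_le_self hq0.le
      _ ≤ _ := by
          rw [eLpNorm'_const_smul _ hq0, Real.enorm_of_nonneg (by positivity)]
          grw [hA]
          rw [← ENNReal.ofReal_mul (by positivity), mul_assoc]
  have := h G t ht (t ^ μ) (by positivity) hhigh
  rw [hGf] at this
  refine this.trans ?_
  grw [hout]
  rw [← hμm, Real.rpow_add ht, ENNReal.ofReal_rpow_of_pos ht, ← ENNReal.ofReal_coe_nnreal,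
    ← ENNReal.ofReal_mul (by positivity), ← ENNReal.ofReal_mul (by positivity),
    show (2 : ℝ≥0∞) = ENNReal.ofReal 2 by simp, ← ENNReal.ofReal_mul (by positivity),
    ← ENNReal.ofReal_add (by positivity) (by positivity)]
  apply ENNReal.ofReal_le_ofReal
  have e1 : 0 ≤ t ^ μ * t ^ (max δ 0) := by positivity
  have e2 : 0 ≤ t ^ (-a) * x := by positivity
  have e3 : 0 ≤ k⁻¹ := by positivity
  have e4 : (0 : ℝ) ≤ C₁ := C₁.2
  nlinarith [mul_nonneg e3 e1, mul_nonneg e4 e2]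

end BrokenWeight

section Scaling

variable {d : ℕ}

theorem brokenWeight_smul_le {A : ℝ × ℝ} (hA1 : 0 < A.1) (hA2 : 0 < A.2) {s : ℝ} (hs : 0 < s)
    (y : EuclideanSpace ℝ (Fin d)) :
    brokenWeight A (s • y) ≤ s ^ (if s < 1 then A.1 else A.2) * (1 + ‖y‖) ^ (A.1 + A.2) := by
  have hy : 0 ≤ ‖y‖ := norm_nonneg y
  have h1y : 1 ≤ 1 + ‖y‖ := by linarith
  have key : ∀ a : ℝ, 0 ≤ a → a ≤ A.1 + A.2 → ‖y‖ ^ a ≤ (1 + ‖y‖) ^ (A.1 + A.2) := fun a h0 h =>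
    (Real.rpow_le_rpow hy (by linarith) h0).trans (Real.rpow_le_rpow_of_exponent_le h1y h)
  unfold brokenWeight
  rw [norm_smul, Real.norm_of_nonneg hs.le]
  split_ifs with h1 h2 h2
  · rw [Real.mul_rpow hs.le hy]
    gcongr
    exact key _ hA1.le (by linarith)
  · calc (s * ‖y‖) ^ A.1 ≤ 1 := Real.rpow_le_one (by positivity) h1.le hA1.le
      _ ≤ _ := one_le_mul_of_one_le_of_one_le (Real.one_le_rpow (not_lt.1 h2) hA2.le)
          (Real.one_le_rpow h1y (by linarith))
  · calc (s * ‖y‖) ^ A.2 ≤ (s * ‖y‖) ^ (A.1 + A.2) :=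
          Real.rpow_le_rpow_of_exponent_le (not_lt.1 h1) (by linarith)
      _ = s ^ (A.1 + A.2) * ‖y‖ ^ (A.1 + A.2) := Real.mul_rpow hs.le hy
      _ ≤ s ^ A.1 * (1 + ‖y‖) ^ (A.1 + A.2) := by
          refine mul_le_mul ?_ (key _ (by linarith) le_rfl) (by positivity) (by positivity)
          exact Real.rpow_le_rpow_of_exponent_ge hs h2.le (by linarith)
  · rw [Real.mul_rpow hs.le hy]
    gcongr
    exact key _ hA2.le (by linarith)

theorem exists_eLpNorm'_one_add_norm_rpow_mul_le (φ : SchwartzMap (EuclideanSpace ℝ (Fin d)) ℂ)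
    (s : ℝ) {p : ℝ} (hp : 1 ≤ p) :
    ∃ K : ℝ, 0 ≤ K ∧ eLpNorm' (fun y => (1 + ‖y‖) ^ s * ‖φ y‖) p volume ≤ ENNReal.ofReal K := by
  have hp0 : 0 < p := by linarith
  obtain ⟨k, hk⟩ := exists_nat_ge (s + (d + 1))
  obtain ⟨M, hM0, hM⟩ : ∃ M : ℝ, 0 ≤ M ∧ ∀ y, (1 + ‖y‖) ^ k * ‖φ y‖ ≤ M :=
    ⟨2 ^ k * ((Finset.Iic (k, 0)).sup fun m => SchwartzMap.seminorm ℂ m.1 m.2) φ, by positivity,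
      fun y => by
        simpa using SchwartzMap.one_add_le_sup_seminorm_apply (𝕜 := ℂ) (m := (k, 0)) le_rfl le_rfl
          φ y⟩
  have hfin : eLpNorm' (fun y : EuclideanSpace ℝ (Fin d) => (1 + ‖y‖) ^ (-(d + 1 : ℝ))) p volume
      < ⊤ := by
    rw [eLpNorm'_eq_lintegral_enorm]
    refine ENNReal.rpow_lt_top_of_nonneg (by positivity) (ne_of_lt ?_)
    have := finite_integral_one_add_norm (E := EuclideanSpace ℝ (Fin d)) (r := (d + 1) * p)
      (μ := volume) (by rw [finrank_euclideanSpace_fin]; nlinarith)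
    refine (lintegral_mono fun y => ?_).trans_lt this
    rw [Real.enorm_of_nonneg (by positivity), ENNReal.ofReal_rpow_of_nonneg (by positivity) hp0.le,
      ← Real.rpow_mul (by positivity), neg_mul]
  refine ⟨M * (eLpNorm' (fun y : EuclideanSpace ℝ (Fin d) => (1 + ‖y‖) ^ (-(d + 1 : ℝ))) p
    volume).toReal, by positivity, ?_⟩
  rw [ENNReal.ofReal_mul hM0, ENNReal.ofReal_toReal hfin.ne, ← Real.enorm_of_nonneg hM0,
    ← eLpNorm'_const_smul _ hp0]
  refine eLpNorm'_mono_ae hp0.le (ae_of_all _ fun y => ?_)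
  have h1y : 1 ≤ 1 + ‖y‖ := by linarith [norm_nonneg y]
  rw [Pi.smul_apply, smul_eq_mul, Real.norm_of_nonneg (by positivity),
    Real.norm_of_nonneg (by positivity)]
  calc (1 + ‖y‖) ^ s * ‖φ y‖ ≤ ((1 + ‖y‖) ^ k * (1 + ‖y‖) ^ (-(d + 1 : ℝ))) * ‖φ y‖ := by
        gcongr
        rw [← Real.rpow_natCast, ← Real.rpow_add (by positivity)]
        exact Real.rpow_le_rpow_of_exponent_le h1y (by linarith)
    _ = (1 + ‖y‖) ^ k * ‖φ y‖ * (1 + ‖y‖) ^ (-(d + 1 : ℝ)) := by ring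
    _ ≤ _ := by gcongr; exact hM y

theorem eLpNorm'_comp_smul {F : Type*} [NormedAddCommGroup F] (g : EuclideanSpace ℝ (Fin d) → F)
    {q : ℝ} {r : ℝ} (hr : 0 < r) (hq : 0 < q) :
    eLpNorm' g q volume =
      ENNReal.ofReal (r ^ (d / q : ℝ)) * eLpNorm' (fun y => g (r • y)) q volume := by
  rw [eLpNorm'_eq_lintegral_enorm, eLpNorm'_eq_lintegral_enorm,
    lintegral_eq_mul_lintegral_comp_smul _ hr, ENNReal.mul_rpow_of_nonneg _ _ (by positivity),
    ENNReal.ofReal_rpow_of_pos (by positivity), finrank_euclideanSpace_fin, ← Real.rpow_natCast,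
    ← Real.rpow_mul hr.le, mul_one_div]

theorem eLpNorm'_brokenWeight_mul_le {A : ℝ × ℝ} (hA1 : 0 < A.1) (hA2 : 0 < A.2)
    {F : Type*} [NormedAddCommGroup F] (g φ : EuclideanSpace ℝ (Fin d) → F) {q : ℝ} (hq : 0 < q)
    {r a K : ℝ} (hr : 0 < r) (ha : 0 ≤ a)
    (hg : ∀ y, ‖g (r • y)‖ = a * ‖φ y‖)
    (hK : eLpNorm' (fun y => (1 + ‖y‖) ^ (A.1 + A.2) * ‖φ y‖) q volume ≤ ENNReal.ofReal K) :
    eLpNorm' (fun y => brokenWeight A y * ‖g y‖) q volume ≤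
      ENNReal.ofReal (a * r ^ (d / q + if r < 1 then A.1 else A.2) * K) := by
  set e := if r < 1 then A.1 else A.2 with he
  rw [eLpNorm'_comp_smul _ hr hq]
  have : eLpNorm' (fun y => brokenWeight A (r • y) * ‖g (r • y)‖) q volume ≤
      ENNReal.ofReal (r ^ e * a * K) := by
    calc _ ≤ eLpNorm' ((r ^ e * a) • fun y => (1 + ‖y‖) ^ (A.1 + A.2) * ‖φ y‖) q volume := by
          refine eLpNorm'_mono_ae hq.le (ae_of_all _ fun y => ?_)
          have h0 := brokenWeight_nonneg A (r • y)
          rw [Pi.smul_apply, smul_eq_mul, Real.norm_of_nonneg (by positivity),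
            Real.norm_of_nonneg (by positivity), hg]
          calc _ ≤ r ^ e * (1 + ‖y‖) ^ (A.1 + A.2) * (a * ‖φ y‖) := by
                gcongr
                exact brokenWeight_smul_le hA1 hA2 hr y
            _ = _ := by ring
      _ ≤ _ := by
          rw [eLpNorm'_const_smul _ hq, Real.enorm_of_nonneg (by positivity)]
          grw [hK]
          rw [← ENNReal.ofReal_mul (by positivity)]
  grw [this]
  rw [← ENNReal.ofReal_mul (by positivity), Real.rpow_add hr]
  apply le_of_eq
  congr 1
  ring

/-- Dilates of a fixed Schwartz function are admissible in the definition of `Hsup`. -/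
theorem exists_ofReal_le_Hsup {p q : ℝ≥0∞} (hp : 1 ≤ p) (hp' : p ≠ ∞) (hq : 1 ≤ q) (hq' : q ≠ ∞)
    {A B : ℝ × ℝ} (hA1 : 0 < A.1) (hA2 : 0 < A.2) (hB1 : 0 < B.1) (hB2 : 0 < B.2)
    {δ : ℝ} (hδ : δ = d * (1 / p.toReal + 1 / q.toReal - 1)) :
    ∃ L K : ℝ, 0 < L ∧ 1 ≤ K ∧ ∀ b r x : ℝ, 0 < b → 0 < r →
      K * b * r ^ (if r < 1 then A.1 else A.2) ≤ x →
      K * b * r⁻¹ ^ (δ + if r⁻¹ < 1 then B.1 else B.2) ≤ 1 →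
      ENNReal.ofReal (b * L) ≤ Hsup d A B q p x := by
  have hp1 : 1 ≤ p.toReal := by simpa using ENNReal.toReal_mono hp' hp
  have hq1 : 1 ≤ q.toReal := by simpa using ENNReal.toReal_mono hq' hq
  have hpz : p ≠ 0 := (zero_lt_one.trans_le hp).ne'
  have hqz : q ≠ 0 := (zero_lt_one.trans_le hq).ne'
  set P := p.toReal with hP
  set Q := q.toReal with hQ
  have hp0 : 0 < P := by linarith
  have hq0 : 0 < Q := by linarith
  obtain ⟨φ, hφ1, -⟩ := exists_schwartz_cutoff (V := EuclideanSpace ℝ (Fin d))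
  have hφ0 : φ 0 ≠ 0 := by rw [hφ1 0 (by simp)]; exact one_ne_zero
  have hN : eLpNorm' (⇑φ) Q volume ≠ 0 := fun h => by
    rw [eLpNorm'_eq_zero_iff hq0 φ.continuous.aestronglyMeasurable] at h
    rw [Continuous.ae_eq_iff_eq _ φ.continuous continuous_zero] at h
    exact hφ0 (by simp [h])
  have hN' : eLpNorm' (⇑φ) Q volume ≠ ⊤ := by
    rw [hQ, ← eLpNorm_eq_eLpNorm' hqz hq']
    exact (φ.memLp q volume).2.ne
  obtain ⟨K₁, hK₁, h₁⟩ := exists_eLpNorm'_one_add_norm_rpow_mul_le φ (A.1 + A.2) hq1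
  obtain ⟨ψ, hψ⟩ : ∃ ψ : SchwartzMap (EuclideanSpace ℝ (Fin d)) ℂ, 𝓕 (⇑φ) = ⇑ψ :=
    ⟨𝓕 φ, (SchwartzMap.fourier_coe φ).symm⟩
  obtain ⟨K₂, hK₂, h₂⟩ := exists_eLpNorm'_one_add_norm_rpow_mul_le ψ (B.1 + B.2) hp1
  refine ⟨(eLpNorm' (⇑φ) Q volume).toReal, 1 + K₁ + K₂, ENNReal.toReal_pos hN hN', by linarith,
    fun b r x hb hr hx h1 => ?_⟩
  set a := b * r ^ (-(d / Q) : ℝ) with ha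
  have ha0 : 0 < a := by positivity
  obtain ⟨f, hf⟩ : ∃ f : SchwartzMap (EuclideanSpace ℝ (Fin d)) ℂ,
      ∀ y, f y = (a : ℂ) * φ (r⁻¹ • y) :=
    ⟨(a : ℂ) • SchwartzMap.compCLMOfContinuousLinearEquiv ℂ
      (ContinuousLinearEquiv.smulLeft (Units.mk0 r⁻¹ (inv_pos.2 hr).ne')) φ, fun y => rfl⟩
  have hfr : ∀ y, ‖f (r • y)‖ = a * ‖φ y‖ := fun y => by
    rw [hf, inv_smul_smul₀ hr.ne', norm_mul, Complex.norm_real, Real.norm_of_nonneg ha0.le]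
  have hF : ∀ ξ, 𝓕 (⇑f) (r⁻¹ • ξ) = (a : ℂ) * (((r ^ d : ℝ) : ℂ) * 𝓕 (⇑φ) ξ) := fun ξ => by
    have := congrFun (VectorFourier.fourierIntegral_const_smul Real.fourierChar volume
      (innerₗ (EuclideanSpace ℝ (Fin d))) (fun y => φ (r⁻¹ • y)) (a : ℂ)) (r⁻¹ • ξ)
    rw [show ⇑f = (a : ℂ) • fun y => φ (r⁻¹ • y) from funext hf]
    refine this.trans ?_
    rw [Pi.smul_apply, smul_eq_mul]
    congr 1
    refine (fourier_comp_inv_smul (⇑φ) hr _).trans ?_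
    rw [smul_inv_smul₀ hr.ne', finrank_euclideanSpace_fin]
  have hFr : ∀ ξ, ‖𝓕 (⇑f) (r⁻¹ • ξ)‖ = a * r ^ d * ‖ψ ξ‖ := fun ξ => by
    rw [hF, hψ, norm_mul, norm_mul, Complex.norm_real, Complex.norm_real,
      Real.norm_of_nonneg ha0.le, Real.norm_of_nonneg (pow_nonneg hr.le d), ← mul_assoc]
  have hfne : f ≠ 0 := fun h => by
    have h0 : f 0 = 0 := by rw [h]; rfl
    rw [hf, smul_zero, mul_eq_zero] at h0
    exact h0.elim (by exact_mod_cast ha0.ne') hφ0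
  have hwA : eLpNorm (fun y => brokenWeight A y * ‖f y‖) q volume ≤ ENNReal.ofReal x := by
    rw [eLpNorm_eq_eLpNorm' hqz hq']
    refine (eLpNorm'_brokenWeight_mul_le hA1 hA2 f φ hq0 hr ha0.le hfr h₁).trans
      (ENNReal.ofReal_le_ofReal (le_trans ?_ hx))
    rw [ha, mul_assoc b, ← Real.rpow_add hr, neg_add_cancel_left]
    have : 0 ≤ b * r ^ (if r < 1 then A.1 else A.2) := by positivity
    nlinarith
  have hwB : eLpNorm (fun ξ => brokenWeight B ξ * ‖𝓕 (⇑f) ξ‖) p volume ≤ 1 := by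
    rw [eLpNorm_eq_eLpNorm' hpz hp']
    refine (eLpNorm'_brokenWeight_mul_le hB1 hB2 _ ψ hp0 (inv_pos.2 hr) (by positivity)
      hFr h₂).trans ?_
    rw [ENNReal.ofReal_le_one]
    refine le_trans ?_ h1
    have e : a * r ^ d = b * r⁻¹ ^ (d / Q - d : ℝ) := by
      rw [ha, ← Real.rpow_natCast, mul_assoc, ← Real.rpow_add hr, Real.inv_rpow hr.le,
        ← Real.rpow_neg hr.le]
      congr 2
      ring
    rw [e, mul_assoc b, ← Real.rpow_add (inv_pos.2 hr),
      show (d / Q - d + (d / P + if r⁻¹ < 1 then B.1 else B.2) : ℝ) =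
        δ + if r⁻¹ < 1 then B.1 else B.2 by rw [hδ]; ring]
    have : 0 ≤ b * r⁻¹ ^ (δ + if r⁻¹ < 1 then B.1 else B.2) := by positivity
    nlinarith
  refine le_trans (le_of_eq ?_) (le_iSup (fun f : {f : SchwartzMap (EuclideanSpace ℝ (Fin d)) ℂ //
      f ≠ 0 ∧ eLpNorm (fun y => brokenWeight A y * ‖f y‖) q volume ≤ ENNReal.ofReal x ∧
      eLpNorm (fun ξ => brokenWeight B ξ * ‖𝓕 (⇑f) ξ‖) p volume ≤ 1} =>
    eLpNorm (⇑f.1) q volume) ⟨f, hfne, hwA, hwB⟩)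
  have hfφ : (fun y => f (r • y)) = (a : ℂ) • ⇑φ := by
    ext y
    rw [hf, inv_smul_smul₀ hr.ne', Pi.smul_apply, smul_eq_mul]
  rw [eLpNorm_eq_eLpNorm' hqz hq', eLpNorm'_comp_smul (⇑f) hr hq0, hfφ, eLpNorm'_const_smul _ hq0,
    ← ofReal_norm, Complex.norm_real, Real.norm_of_nonneg ha0.le, ENNReal.ofReal_mul hb.le,
    ENNReal.ofReal_toReal hN', ← mul_assoc, ← ENNReal.ofReal_mul (by positivity)]
  congr 2
  rw [ha, mul_left_comm, ← Real.rpow_add hr, add_neg_cancel, Real.rpow_zero, mul_one]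

end Scaling

section Asymptotics

variable {d : ℕ} {p q : ℝ≥0∞} {A B : ℝ × ℝ} {δ : ℝ}

theorem Hsup_le_ofReal [Nonempty (Fin d)] (hp : 1 ≤ p) (hpq : p ≤ q) (hq : q ≠ ∞)
    (hA1 : 0 < A.1) (hA2 : 0 < A.2) (hB1 : 0 < B.1) (hB2 : 0 < B.2)
    (hδ : δ = d * (1 / p.toReal + 1 / q.toReal - 1)) (hδB : -δ ≤ B.2) :
    ∃ C : ℝ, 0 < C ∧ ∀ x t : ℝ, 0 < x → 0 < t → Hsup d A B q p x ≤ ENNReal.ofReal (C *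
        (t ^ (if t < 1 then B.2 + δ else max (B.1 + δ) 0) +
          t ^ (-(if t < 1 then A.1 else A.2)) * x)) := by
  have hp' : p ≠ ∞ := ne_top_of_le_ne_top hq hpq
  have hpz : p ≠ 0 := (zero_lt_one.trans_le hp).ne'
  have hqz : q ≠ 0 := (zero_lt_one.trans_le (hp.trans hpq)).ne'
  obtain ⟨C, hC, h⟩ := eLpNorm'_le_of_brokenWeight (d := d)
    (by simpa using ENNReal.toReal_mono hp' hp) (ENNReal.toReal_mono hq hpq) hδ hA1 hA2 hB1 hB2 hδB
  refine ⟨C, hC, fun x t hx ht => iSup_le ?_⟩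
  rintro ⟨f, -, hfA, hfB⟩
  rw [eLpNorm_eq_eLpNorm' hqz hq] at hfA ⊢
  rw [eLpNorm_eq_eLpNorm' hpz hp'] at hfB
  exact h f x hx hfA hfB t ht

theorem rpow_inv_add_balance {a m x : ℝ} (ham : 0 < a + m) (hx : 0 < x) :
    (x ^ (a + m)⁻¹) ^ m = x ^ (m / (a + m)) ∧
      (x ^ (a + m)⁻¹) ^ (-a) * x = x ^ (m / (a + m)) := by
  refine ⟨by rw [← Real.rpow_mul hx.le]; congr 1; field_simp, ?_⟩
  rw [← Real.rpow_mul hx.le, ← Real.rpow_add_one hx.ne']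
  congr 1
  field_simp
  ring

theorem Hsup_le_rpow [Nonempty (Fin d)] (hp : 1 ≤ p) (hpq : p ≤ q) (hq : q ≠ ∞)
    (hA1 : 0 < A.1) (hA2 : 0 < A.2) (hB1 : 0 < B.1) (hB2 : 0 < B.2)
    (hδ : δ = d * (1 / p.toReal + 1 / q.toReal - 1)) (hδB : -δ ≤ B.2) :
    ∃ C : ℝ, 0 < C ∧ ∀ x : ℝ, 0 < x → Hsup d A B q p x ≤ ENNReal.ofReal (C * x ^
      (if x < 1 then (B.2 + δ) / (A.1 + (B.2 + δ))
        else max (B.1 + δ) 0 / (A.2 + max (B.1 + δ) 0))) := by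
  obtain ⟨C, hC, h⟩ := Hsup_le_ofReal hp hpq hq hA1 hA2 hB1 hB2 hδ hδB
  refine ⟨C * 2, by positivity, fun x hx => ?_⟩
  split_ifs with h1
  · have ham : 0 < A.1 + (B.2 + δ) := by linarith
    have ht : x ^ (A.1 + (B.2 + δ))⁻¹ < 1 := Real.rpow_lt_one hx.le h1 (inv_pos.2 ham)
    have := h x _ hx (Real.rpow_pos_of_pos hx (A.1 + (B.2 + δ))⁻¹)
    rw [if_pos ht, if_pos ht, (rpow_inv_add_balance ham hx).1, (rpow_inv_add_balance ham hx).2,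
      ← two_mul, ← mul_assoc] at this
    exact this
  · have ham : 0 < A.2 + max (B.1 + δ) 0 := by positivity
    have ht : ¬ x ^ (A.2 + max (B.1 + δ) 0)⁻¹ < 1 :=
      not_lt.2 (Real.one_le_rpow (not_lt.1 h1) (inv_pos.2 ham).le)
    have := h x _ hx (Real.rpow_pos_of_pos hx (A.2 + max (B.1 + δ) 0)⁻¹)
    rw [if_neg ht, if_neg ht, (rpow_inv_add_balance ham hx).1, (rpow_inv_add_balance ham hx).2,
      ← two_mul, ← mul_assoc] at this
    exact this

theorem rpow_le_Hsup (hp : 1 ≤ p) (hp' : p ≠ ∞) (hq : 1 ≤ q) (hq' : q ≠ ∞)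
    (hA1 : 0 < A.1) (hA2 : 0 < A.2) (hB1 : 0 < B.1) (hB2 : 0 < B.2)
    (hδ : δ = d * (1 / p.toReal + 1 / q.toReal - 1)) (hδB : -δ ≤ B.2) :
    ∃ c : ℝ, 0 < c ∧ ∀ x : ℝ, 0 < x → ENNReal.ofReal (c * x ^
      (if x < 1 then (B.2 + δ) / (A.1 + (B.2 + δ))
        else max (B.1 + δ) 0 / (A.2 + max (B.1 + δ) 0))) ≤ Hsup d A B q p x := by
  obtain ⟨L, K, hL, hK, h⟩ := exists_ofReal_le_Hsup (d := d) hp hp' hq hq' hA1 hA2 hB1 hB2 hδ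
  have hK0 : 0 < K := by linarith
  refine ⟨K⁻¹ * L, by positivity, fun x hx => ?_⟩
  have admissible : ∀ a m b : ℝ, 0 < a + m → b + δ = m →
      (x ^ (a + m)⁻¹ < 1 → a = A.1 ∧ b = B.2) → (1 ≤ x ^ (a + m)⁻¹ → a = A.2 ∧ b = B.1) →
      ENNReal.ofReal (K⁻¹ * L * x ^ (m / (a + m))) ≤ Hsup d A B q p x := by
    intro a m b ham hm hlt hge
    obtain ⟨e1, e2⟩ := rpow_inv_add_balance ham hx
    set r := x ^ (a + m)⁻¹ with hr
    have hr0 : 0 < r := by positivity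
    have hra : r ^ m * r ^ a = x := by
      rw [e1, ← e2, mul_assoc, mul_comm x, ← mul_assoc, ← Real.rpow_add hr0, neg_add_cancel,
        Real.rpow_zero, one_mul]
    have ha : (if r < 1 then A.1 else A.2) = a := by
      split_ifs with hr1
      · exact (hlt hr1).1.symm
      · exact (hge (not_lt.1 hr1)).1.symm
    have hb : r⁻¹ ^ (δ + if r⁻¹ < 1 then B.1 else B.2) = (r ^ m)⁻¹ := by
      rcases lt_trichotomy r 1 with hr1 | hr1 | hr1
      · rw [if_neg (not_lt.2 (one_lt_inv₀ hr0 |>.2 hr1).le), ← (hlt hr1).2, add_comm, hm,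
          Real.inv_rpow hr0.le]
      · simp [hr1]
      · rw [if_pos (inv_lt_one_of_one_lt₀ hr1), ← (hge hr1.le).2, add_comm, hm,
          Real.inv_rpow hr0.le]
    have := h (K⁻¹ * r ^ m) r x (by positivity) hr0
      (by rw [ha, mul_inv_cancel_left₀ hK0.ne', hra])
      (by rw [hb, mul_inv_cancel_left₀ hK0.ne', mul_inv_cancel₀ (by positivity)])
    rwa [e1, mul_right_comm] at this
  split_ifs with h1
  · have ham : 0 < A.1 + (B.2 + δ) := by linarith
    have hr := Real.rpow_lt_one hx.le h1 (inv_pos.2 ham)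
    exact admissible _ _ B.2 ham rfl (fun _ => ⟨rfl, rfl⟩) fun hr' => absurd hr (not_lt.2 hr')
  · rcases le_or_gt 0 (B.1 + δ) with h0 | h0
    · rw [max_eq_left h0]
      have ham : 0 < A.2 + (B.1 + δ) := by linarith
      have hr := Real.one_le_rpow (not_lt.1 h1) (inv_pos.2 ham).le
      exact admissible _ _ B.1 ham rfl (fun hr' => absurd hr' (not_lt.2 hr)) fun _ => ⟨rfl, rfl⟩
    · rw [max_eq_right h0.le, zero_div, Real.rpow_zero, mul_one]
      exact h K⁻¹ 1 x (by positivity) one_pos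
        (by rw [Real.one_rpow, mul_one, mul_inv_cancel₀ hK0.ne']; exact not_lt.1 h1)
        (by rw [inv_one, Real.one_rpow, mul_one, mul_inv_cancel₀ hK0.ne'])

theorem Hsup_eq_top (hp : 1 ≤ p) (hp' : p ≠ ∞) (hq : 1 ≤ q) (hq' : q ≠ ∞)
    (hA1 : 0 < A.1) (hA2 : 0 < A.2) (hB1 : 0 < B.1) (hB2 : 0 < B.2)
    (hδ : δ = d * (1 / p.toReal + 1 / q.toReal - 1)) (hδB : B.2 < -δ) {x : ℝ} (hx : 0 < x) :
    Hsup d A B q p x = ∞ := by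
  obtain ⟨L, K, hL, hK, h⟩ := exists_ofReal_le_Hsup (d := d) hp hp' hq hq' hA1 hA2 hB1 hB2 hδ
  have hK0 : 0 < K := by linarith
  refine ENNReal.eq_top_of_forall_nnreal_le fun N => ?_
  set b : ℝ := (N + 1) / L with hb
  have hb0 : 0 < b := by positivity
  have small : ∀ e : ℝ, 0 < e → ∀ y : ℝ, 0 < y →
      ∀ᶠ r : ℝ in nhdsWithin 0 (Set.Ioi 0), K * b * r ^ e < y := fun e he y hy => by
    have h0 : Filter.Tendsto (fun r : ℝ => K * b * r ^ e) (nhdsWithin 0 (Set.Ioi 0)) (nhds 0) := by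
      have := ((Real.continuousAt_rpow_const 0 e (Or.inr he.le)).tendsto.const_mul
        (K * b)).mono_left (nhdsWithin_le_nhds (s := Set.Ioi 0))
      simpa [Real.zero_rpow he.ne'] using this
    exact h0.eventually_lt_const hy
  obtain ⟨r, ⟨⟨hr1, hr2⟩, hr0⟩, hrlt⟩ := (((small A.1 hA1 x hx).and
    (small (-(δ + B.2)) (by linarith) 1 one_pos)).and self_mem_nhdsWithin |>.and
    (nhdsWithin_le_nhds (Iio_mem_nhds (one_pos (α := ℝ))))).exists
  refine le_trans ?_ (h b r x hb0 hr0 (by rw [if_pos hrlt]; exact hr1.le) ?_)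
  · rw [hb, div_mul_cancel₀ _ hL.ne', ← ENNReal.ofReal_coe_nnreal]
    exact ENNReal.ofReal_le_ofReal (by linarith)
  · rw [if_neg (not_lt.2 ((one_lt_inv₀ hr0).2 hrlt).le), Real.inv_rpow hr0.le,
      ← Real.rpow_neg hr0.le]
    exact hr2.le

end Asymptotics

/-- Theorem 3.1, item (1): for `1 ≤ p ≤ q < ∞`, the extremal function `H` satisfies
`H(x) ≈ x^{e(x)}` if `B₂ ≥ d(1−1/p−1/q)`, and `H ≡ ∞` otherwise. -/
theorem Hsup_asymptotics_p_le_q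
    (d : ℕ) (hd : 1 ≤ d) (p q : ℝ≥0∞) (hp : 1 ≤ p) (hpq : p ≤ q) (hq : q ≠ ∞)
    (A B : ℝ × ℝ) (hA1 : 0 < A.1) (hA2 : 0 < A.2) (hB1 : 0 < B.1) (hB2 : 0 < B.2) :
    (((d : ℝ) * (1 - (1/p).toReal - (1/q).toReal) ≤ B.2 →
      ∃ c C : ℝ, 0 < c ∧ 0 < C ∧ ∀ x : ℝ, 0 < x →
        ENNReal.ofReal (c * x ^
            (if x < 1 then
              (B.2 + (d : ℝ) * ((1/p).toReal + (1/q).toReal - 1)) /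
                (A.1 + (B.2 + (d : ℝ) * ((1/p).toReal + (1/q).toReal - 1)))
            else
              max (B.1 + (d : ℝ) * ((1/p).toReal + (1/q).toReal - 1)) 0 /
                (A.2 + max (B.1 + (d : ℝ) * ((1/p).toReal + (1/q).toReal - 1)) 0))) ≤
          Hsup d A B q p x ∧
        Hsup d A B q p x ≤ ENNReal.ofReal (C * x ^
            (if x < 1 then
              (B.2 + (d : ℝ) * ((1/p).toReal + (1/q).toReal - 1)) /
                (A.1 + (B.2 + (d : ℝ) * ((1/p).toReal + (1/q).toReal - 1)))
            else
              max (B.1 + (d : ℝ) * ((1/p).toReal + (1/q).toReal - 1)) 0 /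
                (A.2 + max (B.1 + (d : ℝ) * ((1/p).toReal + (1/q).toReal - 1)) 0)))) ∧
      (B.2 < (d : ℝ) * (1 - (1/p).toReal - (1/q).toReal) →
        ∀ x : ℝ, 0 < x → Hsup d A B q p x = ∞)) := by
  have : Nonempty (Fin d) := ⟨⟨0, hd⟩⟩
  have hp' : p ≠ ∞ := ne_top_of_le_ne_top hq hpq
  have hδ : (d : ℝ) * ((1/p).toReal + (1/q).toReal - 1) =
      d * (1 / p.toReal + 1 / q.toReal - 1) := by
    simp [ENNReal.toReal_inv]
  have hneg : (d : ℝ) * (1 - (1/p).toReal - (1/q).toReal) =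
      -((d : ℝ) * ((1/p).toReal + (1/q).toReal - 1)) := by ring
  rw [hneg]
  refine ⟨fun h => ?_, fun h x hx => Hsup_eq_top hp hp' (hp.trans hpq) hq hA1 hA2 hB1 hB2 hδ h hx⟩
  obtain ⟨c, hc, hcH⟩ := rpow_le_Hsup hp hp' (hp.trans hpq) hq hA1 hA2 hB1 hB2 hδ h
  obtain ⟨C, hC, hCH⟩ := Hsup_le_rpow hp hpq hq hA1 hA2 hB1 hB2 hδ h
  exact ⟨c, C, hc, hC, fun x hx => ⟨hcH x hx, hCH x hx⟩⟩
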